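/- arXiv:2512.00616 — 6 statements merged into one kernel-verified Lean document; each statement's English description precedes it below -/
import Mathlib

section
/- For any ordinal margin matrix M = (X, ≻), there is at least one Split Cycle winner, i.e., at least one alternative in X that is not defeated by any other alternative according to Split Cycle. -/
variable {X : Type} [DecidableEq X]

/-- `(V, succ)` is an ordinal margin matrix: `V` is a nonempty (finite) set of alternatives
and `succ` (the relation `≻`) is asymmetric, negatively transitive, and ordinally
skew-symmetric on `V × V`. -/
def IsOMM (V : Finset X) (succ : X × X → X × X → Prop) : Prop :=
  V.Nonempty ∧
  (∀ p q : X × X, p.1 ∈ V → p.2 ∈ V → q.1 ∈ V → q.2 ∈ V → succ p q → ¬ succ q p) ∧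
  (∀ p q r : X × X, p.1 ∈ V → p.2 ∈ V → q.1 ∈ V → q.2 ∈ V → r.1 ∈ V → r.2 ∈ V →
      ¬ succ p q → ¬ succ q r → ¬ succ p r) ∧
  (∀ a b c d : X, a ∈ V → b ∈ V → c ∈ V → d ∈ V →
      (succ (a, b) (c, d) ↔ succ (d, c) (b, a)))

/-- A linear ordinal margin matrix: additionally `≻` is connected on pairs of
distinct alternatives, hence a strict linear order there. -/
def IsLinearOMM (V : Finset X) (succ : X × X → X × X → Prop) : Prop :=
  IsOMM V succ ∧
  ∀ a b c d : X, a ∈ V → b ∈ V → c ∈ V → d ∈ V → a ≠ b → c ≠ d → (a, b) ≠ (c, d) →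
    (succ (a, b) (c, d) ∨ succ (c, d) (a, b))

/-- `a` defeats `b` according to Split Cycle in `(V, succ)`: `(a,b) ≻ (b,a)` and there is no
cycle in the majority graph (a duplicate-free list `l` of vertices of `V` whose consecutive
steps, including the wrap-around step — i.e. all the pairs of `l.zip (l.rotate 1)` — are
majority edges) such that `(a,b)` is an edge of the cycle that is weakest in the cycle,
i.e. `(a,b)` is not `≻`-stronger than any edge of the cycle. -/
def SCdefeats (V : Finset X) (succ : X × X → X × X → Prop) (a b : X) : Prop :=
  a ∈ V ∧ b ∈ V ∧ succ (a, b) (b, a) ∧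
    ¬ ∃ l : List X, l.Nodup ∧ (∀ x ∈ l, x ∈ V) ∧
        (∀ e ∈ l.zip (l.rotate 1), succ (e.1, e.2) (e.2, e.1)) ∧
        (a, b) ∈ l.zip (l.rotate 1) ∧
        (∀ e ∈ l.zip (l.rotate 1), ¬ succ (a, b) (e.1, e.2))

/-- `a` is a Split Cycle winner in `(V, succ)`: `a` is not defeated by any alternative. -/
def SCwinner (V : Finset X) (succ : X × X → X × X → Prop) (a : X) : Prop :=
  a ∈ V ∧ ∀ b ∈ V, ¬ SCdefeats V succ b a

/-- Auxiliary definition of Simple Stable Voting winners, by recursion on a fuel parameter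
that is always instantiated to the cardinality of the set of alternatives (deleting a member
of `V` decreases the cardinality by exactly one, so the fuel always matches). -/
def SSVwinAux (succ : X × X → X × X → Prop) : ℕ → Finset X → X → Prop
  | 0, _, _ => False
  | n + 1, V, a =>
      V = {a} ∨
        (1 < V.card ∧ ∃ b ∈ V, a ∈ V.erase b ∧ SSVwinAux succ n (V.erase b) a ∧
          ∀ c d : X, d ∈ V → c ∈ V.erase d → (c, d) ≠ (a, b) →
            SSVwinAux succ n (V.erase d) c → succ (a, b) (c, d))

/-- `a` is a Simple Stable Voting (SSV) winner in `(V, succ)`: either `V = {a}`, or there is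
`b` such that `a` is the SSV winner of `V` with `b` deleted and `(a,b)` is the `≻`-maximal
pair `(c,d)` of distinct alternatives such that `c` is the SSV winner of `V` with `d`
deleted (i.e. `(a,b)` is `≻`-stronger than every other such pair). -/
def SSVwin (V : Finset X) (succ : X × X → X × X → Prop) (a : X) : Prop :=
  SSVwinAux succ V.card V a

/-- Auxiliary definition of Stable Voting winners (fuel-indexed as in `SSVwinAux`). -/
def SVwinAux (succ : X × X → X × X → Prop) : ℕ → Finset X → X → Prop
  | 0, _, _ => False
  | n + 1, V, a =>
      V = {a} ∨
        (1 < V.card ∧ ∃ b ∈ V, a ∈ V.erase b ∧ SCwinner V succ a ∧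
          SVwinAux succ n (V.erase b) a ∧
          ∀ c d : X, d ∈ V → c ∈ V.erase d → (c, d) ≠ (a, b) →
            SCwinner V succ c → SVwinAux succ n (V.erase d) c → succ (a, b) (c, d))

/-- `a` is a Stable Voting (SV) winner in `(V, succ)`: like SSV, but the witnessing pairs
`(c,d)` must additionally have `c` a Split Cycle winner of `(V, succ)`. -/
def SVwin (V : Finset X) (succ : X × X → X × X → Prop) (a : X) : Prop :=
  SVwinAux succ V.card V a

/-- Auxiliary definition of SSV-SE winners (fuel-indexed as in `SSVwinAux`). -/
def SSVSEwinAux (succ : X × X → X × X → Prop) : ℕ → Finset X → X → Prop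
  | 0, _, _ => False
  | n + 1, V, a =>
      V = {a} ∨
        (1 < V.card ∧ ∃ b ∈ V, a ∈ V.erase b ∧ SSVSEwinAux succ n (V.erase b) a ∧
          ∀ c d : X, d ∈ V → c ∈ V.erase d → SSVSEwinAux succ n (V.erase d) c →
            ¬ succ (c, d) (a, b))

/-- `a` is a Simple Stable Voting with Simultaneous Elimination (SSV-SE) winner in
`(V, succ)`: either `V = {a}`, or `a` is the first coordinate of a `≻`-maximal element
`(a,b)` of the set of pairs `(c,d)` of distinct alternatives such that `c` is an SSV-SE
winner of `V` with `d` deleted (maximal: no such pair is `≻`-stronger than `(a,b)`). -/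
def SSVSEwin (V : Finset X) (succ : X × X → X × X → Prop) (a : X) : Prop :=
  SSVSEwinAux succ V.card V a

/-- `succ'` is a linearization of `succ` on `V`: `succ'` is a linear ordinal margin matrix
relation on `V` extending `succ` on `V`. -/
def IsLinearization (V : Finset X) (succ succ' : X × X → X × X → Prop) : Prop :=
  IsLinearOMM V succ' ∧
  ∀ p q : X × X, p.1 ∈ V → p.2 ∈ V → q.1 ∈ V → q.2 ∈ V → succ p q → succ' p q

/-- `a` is an SSV-PUT (parallel-universe tiebreaking) winner in `(V, succ)`:
`a` is the SSV winner of some linearization of `(V, succ)`. -/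
def SSVPUTwin (V : Finset X) (succ : X × X → X × X → Prop) (a : X) : Prop :=
  ∃ succ' : X × X → X × X → Prop, IsLinearization V succ succ' ∧ SSVwin V succ' a

/-- `r` is a strict linear order on (the elements of) `V`. -/
def IsLinOrderOn (V : Finset X) (r : X → X → Prop) : Prop :=
  (∀ a ∈ V, ¬ r a a) ∧
  (∀ a ∈ V, ∀ b ∈ V, ∀ c ∈ V, r a b → r b c → r a c) ∧
  (∀ a ∈ V, ∀ b ∈ V, a ≠ b → (r a b ∨ r b a))

open Classical in
/-- The margin of `a` vs. `b` in the profile `P` with voters `Fin m`: the number of voters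
ranking `a` above `b` minus the number of voters ranking `b` above `a`. -/
noncomputable def margin {m : ℕ} (P : Fin m → X → X → Prop) (a b : X) : ℤ :=
  ((Finset.univ.filter fun i => P i a b).card : ℤ) -
  ((Finset.univ.filter fun i => P i b a).card : ℤ)

theorem exists_weakest_aux {X : Type} (V : Finset X) (succ : X × X → X × X → Prop)
    (hasym : ∀ p q : X × X, p.1 ∈ V → p.2 ∈ V → q.1 ∈ V → q.2 ∈ V → succ p q → ¬ succ q p)
    (hneg : ∀ p q r : X × X, p.1 ∈ V → p.2 ∈ V → q.1 ∈ V → q.2 ∈ V → r.1 ∈ V → r.2 ∈ V →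
      ¬ succ p q → ¬ succ q r → ¬ succ p r)
    (L : List (X × X)) (hL : L ≠ []) (hV : ∀ e ∈ L, e.1 ∈ V ∧ e.2 ∈ V) :
    ∃ e ∈ L, ∀ e' ∈ L, ¬ succ e e' := by
  induction L with
  | nil => exact absurd rfl hL
  | cons a t ih =>
    have ha := hV a (by simp)
    have haa : ¬ succ a a := fun h => hasym a a ha.1 ha.2 ha.1 ha.2 h h
    by_cases ht : t = []
    · subst ht
      exact ⟨a, by simp, by simpa using haa⟩
    · have hVt : ∀ e ∈ t, e.1 ∈ V ∧ e.2 ∈ V := fun e he => hV e (List.mem_cons_of_mem _ he)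
      obtain ⟨e, het, hmin⟩ := ih ht hVt
      have he := hVt e het
      by_cases hea : succ e a
      · refine ⟨a, by simp, ?_⟩
        intro e' he'
        rcases List.mem_cons.1 he' with rfl | he'
        · exact haa
        · have h' := hVt e' he'
          exact hneg a e e' ha.1 ha.2 he.1 he.2 h'.1 h'.2
            (hasym e a he.1 he.2 ha.1 ha.2 hea) (hmin e' he')
      · refine ⟨e, List.mem_cons_of_mem _ het, ?_⟩
        intro e' he'
        rcases List.mem_cons.1 he' with rfl | he'
        · exact hea
        · exact hmin e' he'

theorem exists_cycle_aux {Y : Type} [Finite Y] [Nonempty Y] (f : Y → Y) :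
    ∃ l : List Y, l ≠ [] ∧ l.Nodup ∧ ∀ e ∈ l.zip (l.rotate 1), e.1 = f e.2 := by
  obtain ⟨x⟩ := ‹Nonempty Y›
  obtain ⟨y, hy⟩ : ∃ y, y ∈ Function.periodicPts f := by
    obtain ⟨m, n, hmn, h⟩ := Finite.exists_ne_map_eq_of_infinite (fun n : ℕ => f^[n] x)
    wlog hlt : m < n generalizing m n
    · exact this n m hmn.symm h.symm (by omega)
    refine ⟨f^[m] x, n - m, by omega, ?_⟩
    change f^[n - m] (f^[m] x) = f^[m] x
    rw [← Function.iterate_add_apply, Nat.sub_add_cancel hlt.le]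
    exact h.symm
  have hp := Function.minimalPeriod_pos_of_mem_periodicPts hy
  have hper : f^[Function.minimalPeriod f y] y = y := Function.iterate_minimalPeriod
  have hinj := Function.iterate_injOn_Iio_minimalPeriod (f := f) (x := y)
  generalize Function.minimalPeriod f y = p at hp hper hinj
  refine ⟨List.ofFn (fun i : Fin p => f^[p - 1 - i] y), ?_, ?_, ?_⟩
  · rw [← List.length_pos_iff_ne_nil]
    simpa using hp
  · rw [List.nodup_ofFn]
    intro i j hij
    have := hinj (show p - 1 - (i : ℕ) ∈ Set.Iio p from by simp; omega)
      (show p - 1 - (j : ℕ) ∈ Set.Iio p from by simp; omega) hij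
    ext
    omega
  · intro e he
    obtain ⟨i, hi, rfl⟩ := List.mem_iff_getElem.1 he
    have hip : i < p := by simpa using hi
    simp only [List.getElem_zip, List.getElem_rotate, List.getElem_ofFn, List.length_ofFn]
    rw [← Function.iterate_succ_apply' f]
    by_cases h1 : i + 1 < p
    · rw [Nat.mod_eq_of_lt h1]
      congr 2
      omega
    · have h2 : i + 1 = p := by omega
      rw [h2, Nat.mod_self]
      have h3 : p - 1 - i = 0 := by omega
      have h4 : (p - 1 - 0).succ = p := by omega
      rw [h3, h4, hper]
      rfl

/-- For any ordinal margin matrix `M = (X, ≻)`, there is at least one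
Split Cycle winner. -/
theorem exists_split_cycle_winner {X : Type} [DecidableEq X] (V : Finset X)
    (succ : X × X → X × X → Prop) (h : IsOMM V succ) :
    ∃ a, SCwinner V succ a := by
  obtain ⟨hne, hasym, hneg, -⟩ := h
  by_contra hno
  have hdef : ∀ a : {x // x ∈ V}, ∃ b : {x // x ∈ V}, SCdefeats V succ b a := by
    intro a
    by_contra hb
    exact hno ⟨a, a.2, fun b hbV hd => hb ⟨⟨b, hbV⟩, hd⟩⟩
  choose f hf using hdef
  haveI : Nonempty {x // x ∈ V} := ⟨⟨hne.choose, hne.choose_spec⟩⟩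
  obtain ⟨l, hl, hnd, hcyc⟩ := exists_cycle_aux f
  have hzip : ∀ e ∈ (l.map Subtype.val).zip ((l.map Subtype.val).rotate 1),
      SCdefeats V succ e.1 e.2 := by
    intro e he
    rw [← List.map_rotate, List.zip_map, List.mem_map] at he
    obtain ⟨e', he', rfl⟩ := he
    have := hcyc e' he'
    simp only [Prod.map_fst, Prod.map_snd, this]
    exact hf e'.2
  obtain ⟨e, he, hmin⟩ := exists_weakest_aux V succ hasym hneg
    ((l.map Subtype.val).zip ((l.map Subtype.val).rotate 1))
    (by
      rw [← List.length_pos_iff_ne_nil] at hl ⊢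
      simpa using hl)
    (fun e he => ⟨(hzip e he).1, (hzip e he).2.1⟩)
  refine (hzip e he).2.2.2 ⟨l.map Subtype.val, hnd.map Subtype.val_injective, ?_,
    fun e' he' => (hzip e' he').2.2.1, he, hmin⟩
  intro x hx
  obtain ⟨y, -, rfl⟩ := List.mem_map.1 hx
  exact y.2
end

section
/- For every linear ordinal margin matrix M = (X, ≻), there is a unique SSV (Simple Stable Voting) winner. -/
variable {X : Type} [DecidableEq X]

theorem exists_strongest {α : Type} (R : α → α → Prop) (S : Finset α) (hS : S.Nonempty)
    (htr : ∀ p ∈ S, ∀ q ∈ S, ∀ r ∈ S, R p q → R q r → R p r)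
    (hcon : ∀ p ∈ S, ∀ q ∈ S, p ≠ q → R p q ∨ R q p) :
    ∃ p ∈ S, ∀ q ∈ S, q ≠ p → R p q := by
  classical
  induction hS using Finset.Nonempty.cons_induction with
  | singleton a => exact ⟨a, by simp, by simp⟩
  | cons a s ha hs ih =>
    obtain ⟨p, hp, hmax⟩ := ih
      (fun p hp q hq r hr => htr p (by simp [hp]) q (by simp [hq]) r (by simp [hr]))
      (fun p hp q hq => hcon p (by simp [hp]) q (by simp [hq]))
    have hpa : p ≠ a := fun e => ha (e ▸ hp)
    rcases hcon p (by simp [hp]) a (by simp) hpa with h | h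
    · refine ⟨p, by simp [hp], fun q hq hqp => ?_⟩
      rcases Finset.mem_cons.1 hq with rfl | hq
      · exact h
      · exact hmax q hq hqp
    · refine ⟨a, by simp, fun q hq hqa => ?_⟩
      rcases Finset.mem_cons.1 hq with rfl | hq
      · exact absurd rfl hqa
      · by_cases hqp : q = p
        · exact hqp ▸ h
        · exact htr a (by simp) p (by simp [hp]) q (by simp [hq]) h (hmax q hq hqp)

theorem ssvwinAux_mem {X : Type} [DecidableEq X] (succ : X × X → X × X → Prop)
    (n : ℕ) (V : Finset X) (a : X) (h : SSVwinAux succ n V a) : a ∈ V := by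
  cases n with
  | zero => exact h.elim
  | succ n =>
    rcases h with h | ⟨_, b, _, h, _⟩
    · simp [h]
    · exact Finset.mem_of_mem_erase h

theorem unique_aux {X : Type} [DecidableEq X] (V : Finset X)
    (succ : X × X → X × X → Prop) (h : IsLinearOMM V succ) (n : ℕ) :
    ∀ W ⊆ V, W.card = n + 1 → ∃! a, SSVwinAux succ (n + 1) W a := by
  classical
  obtain ⟨⟨-, hasym, hneg, -⟩, hlin⟩ := h
  induction n with
  | zero =>
    intro W _ hc
    obtain ⟨a, rfl⟩ := Finset.card_eq_one.1 hc
    refine ⟨a, Or.inl rfl, ?_⟩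
    intro y hy
    simpa using ssvwinAux_mem _ _ _ _ hy
  | succ n ih =>
    intro W hW hc
    let S : Finset (X × X) := (W ×ˢ W).filter
      fun p => p.1 ≠ p.2 ∧ SSVwinAux succ (n + 1) (W.erase p.2) p.1
    have hS : ∀ p, p ∈ S ↔ (p.1 ∈ W ∧ p.2 ∈ W) ∧ p.1 ≠ p.2 ∧
        SSVwinAux succ (n + 1) (W.erase p.2) p.1 := by
      intro p; simp [S]
    have hne : S.Nonempty := by
      obtain ⟨b, hb⟩ : W.Nonempty := Finset.card_pos.1 (by omega)
      obtain ⟨a, ha, -⟩ := ih (W.erase b) ((Finset.erase_subset _ _).trans hW)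
        (by rw [Finset.card_erase_of_mem hb]; omega)
      have hm := Finset.mem_erase.1 (ssvwinAux_mem _ _ _ _ ha)
      exact ⟨(a, b), (hS _).2 ⟨⟨hm.2, hb⟩, hm.1, ha⟩⟩
    have mem : ∀ p ∈ S, p.1 ∈ V ∧ p.2 ∈ V := fun p hp =>
      ⟨hW ((hS p).1 hp).1.1, hW ((hS p).1 hp).1.2⟩
    obtain ⟨⟨a, b⟩, hab, hmax⟩ := exists_strongest succ S hne
      (by
        intro p hp q hq r hr hpq hqr
        by_contra hpr
        exact hneg p r q (mem p hp).1 (mem p hp).2 (mem r hr).1 (mem r hr).2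
          (mem q hq).1 (mem q hq).2 hpr
          (hasym q r (mem q hq).1 (mem q hq).2 (mem r hr).1 (mem r hr).2 hqr) hpq)
      (by
        intro p hp q hq hpq
        exact hlin p.1 p.2 q.1 q.2 (mem p hp).1 (mem p hp).2 (mem q hq).1 (mem q hq).2
          ((hS p).1 hp).2.1 ((hS q).1 hq).2.1 hpq)
    have hab' := (hS _).1 hab
    refine ⟨a, Or.inr ⟨by omega, b, hab'.1.2, Finset.mem_erase.2 ⟨hab'.2.1, hab'.1.1⟩,
      hab'.2.2, ?_⟩, ?_⟩
    · intro c d hd hcd hne' hw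
      have hm := Finset.mem_erase.1 hcd
      exact hmax (c, d) ((hS _).2 ⟨⟨hm.2, hd⟩, hm.1, hw⟩) hne'
    · intro y hy
      rcases hy with hy | ⟨_, d, hd, hyd, hw, hall⟩
      · rw [hy] at hc
        simp at hc
      · by_contra hya
        have hm := Finset.mem_erase.1 hyd
        have hyS : (y, d) ∈ S := (hS _).2 ⟨⟨hm.2, hd⟩, hm.1, hw⟩
        have hn : (y, d) ≠ (a, b) := fun e => hya (congrArg Prod.fst e)
        have h1 := hmax (y, d) hyS hn
        have h2 := hall a b hab'.1.2 (Finset.mem_erase.2 ⟨hab'.2.1, hab'.1.1⟩) hn.symm hab'.2.2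
        exact hasym _ _ (mem _ hab).1 (mem _ hab).2 (mem _ hyS).1 (mem _ hyS).2 h1 h2

/-- For every linear ordinal margin matrix, there is a unique SSV winner. -/
theorem unique_ssv_winner {X : Type} [DecidableEq X] (V : Finset X)
    (succ : X × X → X × X → Prop) (h : IsLinearOMM V succ) :
    ∃! a, SSVwin V succ a := by
  obtain ⟨n, hn⟩ : ∃ n, V.card = n + 1 :=
    ⟨V.card - 1, by have := Finset.card_pos.2 h.1.1; omega⟩
  unfold SSVwin
  rw [hn]
  exact unique_aux V succ h n V (Finset.Subset.refl V) hn
end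

section
/- For any positive integer n: if for every linear ordinal margin matrix with at most n alternatives the SSV winner is a Split Cycle winner, then the Stable Voting (SV) winner coincides with the SSV winner for every linear ordinal margin matrix with at most n alternatives. -/
variable {X : Type} [DecidableEq X]

theorem exists_top {α : Type} [DecidableEq α] (r : α → α → Prop) (S : Finset α)
    (hS : S.Nonempty)
    (htr : ∀ p ∈ S, ∀ q ∈ S, ∀ t ∈ S, r p q → r q t → r p t)
    (htot : ∀ p ∈ S, ∀ q ∈ S, p ≠ q → r p q ∨ r q p) :
    ∃ m ∈ S, ∀ q ∈ S, q ≠ m → r m q := by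
  induction hS using Finset.Nonempty.cons_induction with
  | singleton a =>
    refine ⟨a, by simp, ?_⟩
    intro q hq hne
    exact absurd (Finset.mem_singleton.1 hq) hne
  | cons a s ha hs ih =>
    obtain ⟨m, hm, hmax⟩ := ih
      (fun p hp q hq t ht => htr p (Finset.mem_cons_of_mem hp) q (Finset.mem_cons_of_mem hq) t
        (Finset.mem_cons_of_mem ht))
      (fun p hp q hq => htot p (Finset.mem_cons_of_mem hp) q (Finset.mem_cons_of_mem hq))
    have hma : m ≠ a := fun h => ha (h ▸ hm)
    have hm2 : m ∈ Finset.cons a s ha := Finset.mem_cons_of_mem hm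
    have ha2 : a ∈ Finset.cons a s ha := Finset.mem_cons.2 (Or.inl rfl)
    rcases htot m hm2 a ha2 hma with h | h
    · refine ⟨m, hm2, fun q hq hne => ?_⟩
      rcases Finset.mem_cons.1 hq with rfl | hq
      · exact h
      · exact hmax q hq hne
    · refine ⟨a, ha2, fun q hq hne => ?_⟩
      rcases Finset.mem_cons.1 hq with rfl | hq'
      · exact absurd rfl hne
      · by_cases hqm : q = m
        · rw [hqm]; exact h
        · exact htr a ha2 m hm2 q hq h (hmax q hq' hqm)

theorem isLinearOMM_mono {Y : Type} {V W : Finset Y} {succ : Y × Y → Y × Y → Prop}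
    (hV : IsLinearOMM V succ) (hWV : W ⊆ V) (hW : W.Nonempty) : IsLinearOMM W succ := by
  obtain ⟨⟨_, h1, h2, h3⟩, h4⟩ := hV
  refine ⟨⟨hW, ?_, ?_, ?_⟩, ?_⟩
  · exact fun p q a b c d => h1 p q (hWV a) (hWV b) (hWV c) (hWV d)
  · exact fun p q r a b c d e f =>
      h2 p q r (hWV a) (hWV b) (hWV c) (hWV d) (hWV e) (hWV f)
  · exact fun p q r s a b c d => h3 p q r s (hWV a) (hWV b) (hWV c) (hWV d)
  · exact fun p q r s a b c d => h4 p q r s (hWV a) (hWV b) (hWV c) (hWV d)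

theorem ssvAux_mem {Y : Type} [DecidableEq Y] {succ : Y × Y → Y × Y → Prop} {k : ℕ}
    {V : Finset Y} {a : Y} (h : SSVwinAux succ k V a) : a ∈ V := by
  cases k with
  | zero => exact h.elim
  | succ k =>
    rcases h with h | ⟨_, b, _, h, _⟩
    · rw [h]; simp
    · exact Finset.mem_of_mem_erase h

theorem ssvAux_exists {Y : Type} [DecidableEq Y] (succ : Y × Y → Y × Y → Prop) (k : ℕ) :
    ∀ V : Finset Y, V.card = k → IsLinearOMM V succ → ∃ a, SSVwinAux succ k V a := by
  classical
  induction k with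
  | zero =>
    intro V hk hV
    exact absurd hk (Finset.card_pos.2 hV.1.1).ne'
  | succ k ih =>
    intro V hk hV
    by_cases h1 : V.card = 1
    · obtain ⟨a, ha⟩ := Finset.card_eq_one.1 h1
      exact ⟨a, Or.inl ha⟩
    have hgt : 1 < V.card := by omega
    obtain ⟨d, hd⟩ := hV.1.1
    have hcd : (V.erase d).card = k := by rw [Finset.card_erase_of_mem hd]; omega
    obtain ⟨c, hc⟩ := ih (V.erase d) hcd
      (isLinearOMM_mono hV (Finset.erase_subset _ _) (Finset.card_pos.1 (by omega)))
    let S := (V ×ˢ V).filter fun p => p.1 ≠ p.2 ∧ SSVwinAux succ k (V.erase p.2) p.1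
    have hS : ∀ p : Y × Y, p ∈ S ↔
        (p.1 ∈ V ∧ p.2 ∈ V) ∧ p.1 ≠ p.2 ∧ SSVwinAux succ k (V.erase p.2) p.1 := by
      intro p; simp [S]
    have hcm := Finset.mem_erase.1 (ssvAux_mem hc)
    obtain ⟨⟨a, b⟩, hm, hmax⟩ := exists_top succ S
      ⟨(c, d), (hS _).2 ⟨⟨hcm.2, hd⟩, hcm.1, hc⟩⟩
      (by
        intro p hp q hq t ht hpq hqt
        have hp := ((hS _).1 hp).1
        have hq := ((hS _).1 hq).1
        have ht := ((hS _).1 ht).1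
        by_contra hpt
        exact hV.1.2.2.1 p t q hp.1 hp.2 ht.1 ht.2 hq.1 hq.2 hpt
          (hV.1.2.1 q t hq.1 hq.2 ht.1 ht.2 hqt) hpq)
      (by
        intro p hp q hq hne
        have hp := (hS _).1 hp
        have hq := (hS _).1 hq
        exact hV.2 p.1 p.2 q.1 q.2 hp.1.1 hp.1.2 hq.1.1 hq.1.2 hp.2.1 hq.2.1 hne)
    have hm := (hS _).1 hm
    refine ⟨a, Or.inr ⟨hgt, b, hm.1.2, Finset.mem_erase.2 ⟨hm.2.1, hm.1.1⟩, hm.2.2, ?_⟩⟩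
    intro c d hd hc hne hw
    have hc := Finset.mem_erase.1 hc
    exact hmax (c, d) ((hS _).2 ⟨⟨hc.2, hd⟩, hc.1, hw⟩) hne

/-- For any positive integer `n`, if for every linear ordinal margin matrix with
at most `n` alternatives the SSV winner is a Split Cycle winner, then SV coincides with SSV
for every linear ordinal margin matrix with at most `n` alternatives. -/
theorem sv_eq_ssv_of_ssv_refines_sc (n : ℕ) (hn : 0 < n)
    (H : ∀ (Y : Type) [DecidableEq Y] (V : Finset Y) (succ : Y × Y → Y × Y → Prop),
      V.card ≤ n → IsLinearOMM V succ → ∀ a, SSVwin V succ a → SCwinner V succ a) :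
    ∀ (Y : Type) [DecidableEq Y] (V : Finset Y) (succ : Y × Y → Y × Y → Prop),
      V.card ≤ n → IsLinearOMM V succ → ∀ a, (SVwin V succ a ↔ SSVwin V succ a) := by
  intro Y _ V succ hVn hV
  suffices h : ∀ k : ℕ, ∀ V : Finset Y, V.card = k → k ≤ n → IsLinearOMM V succ →
      ∀ a, (SVwinAux succ k V a ↔ SSVwinAux succ k V a) from h V.card V rfl hVn hV
  clear hV hVn V
  intro k
  induction k with
  | zero => intro V _ _ _ a; exact Iff.rfl
  | succ k ih =>
    intro V hk hkn hV a
    have hSC : ∀ a, SSVwinAux succ (k + 1) V a → SCwinner V succ a := by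
      intro a ha
      refine H Y V succ (by omega) hV a ?_
      unfold SSVwin
      rw [hk]; exact ha
    have ih2 : 1 < V.card → ∀ d ∈ V, ∀ c,
        (SVwinAux succ k (V.erase d) c ↔ SSVwinAux succ k (V.erase d) c) := by
      intro hgt d hd
      have hcd : (V.erase d).card = k := by rw [Finset.card_erase_of_mem hd]; omega
      exact ih (V.erase d) hcd (by omega)
        (isLinearOMM_mono hV (Finset.erase_subset _ _) (Finset.card_pos.1 (by omega)))
    constructor
    · rintro (h | ⟨hgt, b, hb, hab, hsc, hw, hmax⟩)
      · exact Or.inl h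
      · obtain ⟨a', ha'⟩ := ssvAux_exists succ (k + 1) V hk hV
        have hsc' := hSC a' ha'
        have ha2 := ha'
        rcases ha' with h | ⟨_, b', hb', hab', hw', hmax'⟩
        · rw [h] at hgt; simp at hgt
        · by_cases he : (a', b') = (a, b)
          · rw [← (Prod.mk.inj he).1]; exact ha2
          · have h1 := hmax a' b' hb' hab' he hsc' ((ih2 hgt b' hb' a').2 hw')
            have h2 := hmax' a b hb hab (Ne.symm he) ((ih2 hgt b hb a).1 hw)
            exact absurd h2 (hV.1.2.1 (a, b) (a', b') (Finset.mem_of_mem_erase hab) hb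
              (Finset.mem_of_mem_erase hab') hb' h1)
    · intro ha
      have hsc := hSC a ha
      rcases ha with h | ⟨hgt, b, hb, hab, hw, hmax⟩
      · exact Or.inl h
      · exact Or.inr ⟨hgt, b, hb, hab, hsc, (ih2 hgt b hb a).2 hw,
          fun c d hd hc hne _ hcw => hmax c d hd hc hne ((ih2 hgt d hd c).1 hcw)⟩
end

section
/- For any linear ordinal margin matrix M with at most 6 alternatives, the SSV winner of M is a Split Cycle winner of M. -/
variable {X : Type} [DecidableEq X]

/-! ## A small verified refutation checker -/

namespace SSVCheck

/-- Code of the reversed edge; the edge `(a, b)` has code `6 * a + b`. -/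
def revE (e : ℕ) : ℕ := (e % 6) * 6 + e / 6

/-- The smaller of two numbers (kernel friendly). -/
def mn (a b : ℕ) : ℕ := bif Nat.ble a b then a else b

/-- Canonical literal for edge `e` is stronger than edge `f`. -/
def gLit (e f : ℕ) : ℕ :=
  bif Nat.ble (mn (e * 36 + f) (revE f * 36 + revE e)) (mn (f * 36 + e) (revE e * 36 + revE f))
  then 2 * mn (e * 36 + f) (revE f * 36 + revE e)
  else 2 * mn (f * 36 + e) (revE e * 36 + revE f) + 1

/-- Literal for `x` wins in the set coded by `A`. -/
def fLit (A x : ℕ) : ℕ := 2 * (1296 + A * 6 + x)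

/-- Literal for `(x, e)` being the maximal pair in the set coded by `A`. -/
def wLit (A x e : ℕ) : ℕ := 2 * (1680 + (A * 6 + x) * 6 + e)

/-- Members of the set coded by `A`. -/
def bits (A : ℕ) : List ℕ := [0, 1, 2, 3, 4, 5].filter fun i => A.testBit i

/-- Is `e` the code of an edge between distinct alternatives below `N`? -/
def okE (N e : ℕ) : Bool :=
  Nat.ble (e / 6 + 1) N && Nat.ble (e % 6 + 1) N && !Nat.beq (e / 6) (e % 6)

/-- Base `b` digits, shifted by one. -/
def digs (b : ℕ) : ℕ → ℕ → List ℕ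
  | 0, _ => []
  | k + 1, n => bif Nat.beq n 0 then [] else (n % b - 1) :: digs b k (n / b)

/-- Is `A` the code of a nonempty set of alternatives below `N`? -/
def okA (N A : ℕ) : Bool := Nat.ble 1 A && Nat.ble (A + 1) (2 ^ N)

/-- Membership test. -/
def mem (A x : ℕ) : Bool := Nat.ble (x + 1) 6 && A.testBit x

/-- `A` without `x` (for `x` in `A`). -/
def del (A x : ℕ) : ℕ := A - 2 ^ x

/-- Literals saying that the edges of the path through `q` from `a` to `4`
are weaker than the edge `(4, 0)`. -/
def pathLits : ℕ → List ℕ → List ℕ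
  | a, [] => [gLit 24 (6 * a + 4)]
  | a, x :: q => gLit 24 (6 * a + x) :: pathLits x q

/-- No repetitions, and all entries below `N` and different from `0`, `4`. -/
def okPath (N : ℕ) : List ℕ → Bool
  | [] => true
  | x :: q => Nat.ble (x + 1) N && !Nat.beq x 0 && !Nat.beq x 4 &&
      q.all (fun y => !Nat.beq x y) && okPath N q

/-- A clause that is always true. -/
def taut : List ℕ := [0, 1]

/-- The axiom clause with the given code. -/
def axClause (N : ℕ) (facts : List (ℕ × ℕ)) : List ℕ → List ℕ
  | [] => taut
  | 0 :: l => match l with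
    | [e, f, g] => bif okE N e && okE N f && okE N g && !Nat.beq e f && !Nat.beq f g && !Nat.beq e g
        then [gLit f e, gLit g f, gLit e g] else taut
    | _ => taut
  | 1 :: l => match l with
    | [A] => bif okA N A then (bits A).map (fLit A) else taut
    | _ => taut
  | 2 :: l => match l with
    | [A, x, y] => bif okA N A && mem A x && mem A y && !Nat.beq x y
        then [fLit A x + 1, fLit A y + 1] else taut
    | _ => taut
  | 3 :: l => match l with
    | [A, x] => bif okA N A && mem A x && !Nat.beq A (2 ^ x)
        then (fLit A x + 1) :: ((bits A).filter fun e => !Nat.beq e x).map (wLit A x) else taut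
    | _ => taut
  | 4 :: l => match l with
    | [A, x, e] => bif okA N A && mem A x && mem A e && !Nat.beq e x
        then [wLit A x e + 1, fLit (del A e) x] else taut
    | _ => taut
  | 5 :: l => match l with
    | [A, x, e, c, d] => bif okA N A && mem A x && mem A e && mem A c && mem A d &&
          !Nat.beq e x && !Nat.beq c d && !(Nat.beq c x && Nat.beq d e)
        then [wLit A x e + 1, fLit (del A d) c + 1, gLit (6 * x + e) (6 * c + d)] else taut
    | _ => taut
  | 6 :: _ => [gLit 24 4]
  | 7 :: l => match l with
    | [x, d] => bif okE N (6 * x + d) && Nat.ble (d + 1) 6 && !Nat.beq (6 * x + d) 4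
        then [fLit (del (2 ^ N - 1) d) x + 1, gLit 4 (6 * x + d)] else taut
    | _ => taut
  | 8 :: l => match l with
    | [d] => bif Nat.ble (d + 1) N && !Nat.beq d 0 && !Nat.beq d 4
        then [fLit (del (2 ^ N - 1) d) 0 + 1] else taut
    | _ => taut
  | 9 :: q => bif okPath N q then pathLits 0 q else taut
  | 10 :: l => match l with
    | [d, x] => bif facts.any (fun p => Nat.beq p.1 d && Nat.beq p.2 x)
        then [fLit (del (2 ^ N - 1) d) x] else taut
    | _ => taut
  | _ => taut

/-- Clause database, indexed by natural numbers. -/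
inductive Tr
  | nil : Tr
  | node : List ℕ → Tr → Tr → Tr

/-- Look up a clause. -/
def Tr.get : Tr → ℕ → List ℕ
  | .nil, _ => taut
  | .node c l r, n => bif Nat.beq n 0 then c else
      bif Nat.beq (n % 2) 1 then l.get (n / 2) else r.get (n / 2 - 1)

/-- Insert a clause at the given index. -/
def Tr.ins (c : List ℕ) : Tr → ℕ → Tr
  | .nil, _ => .node c .nil .nil
  | .node c' l r, n => bif Nat.beq n 0 then .node c l r else
      bif Nat.beq (n % 2) 1 then .node c' (l.ins c (n / 2)) r else .node c' l (r.ins c (n / 2 - 1))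

/-- Literals of a clause that are not marked false in `F`. -/
def remLits (F : ℕ) : List ℕ → List ℕ
  | [] => []
  | l :: C => bif F.testBit l then remLits F C else l :: remLits F C

/-- Opposite literal. -/
def opp (l : ℕ) : ℕ := bif Nat.beq (l % 2) 0 then l + 1 else l - 1

/-- Unit propagation along hints; `true` on reaching a conflict. -/
def prop (t : Tr) : List ℕ → ℕ → Bool
  | [], _ => false
  | h :: hs, F => match remLits F (t.get h) with
    | [] => true
    | [l] => prop t hs (F ||| 2 ^ opp l)
    | _ => false

/-- Mark all literals of a clause. -/
def mark : List ℕ → ℕ → ℕ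
  | [], F => F
  | l :: C, F => mark C (F ||| 2 ^ l)

/-- Load the axiom clauses. -/
def load (N : ℕ) (facts : List (ℕ × ℕ)) : List ℕ → Tr → ℕ → Tr × ℕ
  | [], t, n => (t, n)
  | a :: as, t, n => load N facts as (t.ins (axClause N facts (digs 64 8 a)) n) (n + 1)

/-- Run the derivation steps. -/
def run : List ℕ → Tr → ℕ → Bool
  | [], _, _ => false
  | s :: ss, t, n => match digs 8192 1000 s with
    | [] => false
    | k :: ds => bif prop t (ds.drop k) (mark (ds.take k) 0)
        then (match k with | 0 => true | _ + 1 => run ss (t.ins (ds.take k) n) (n + 1)) else false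

/-- The complete check. -/
def check (N : ℕ) (facts : List (ℕ × ℕ)) (axs steps : List ℕ) : Bool :=
  run steps (load N facts axs .nil 0).1 (load N facts axs .nil 0).2

/-- Axiom instances used in the refutation of case Five. -/
def axFive : List ℕ := [
  2164531462, 4994817, 1844033, 386, 1857089, 12426, 529669, 1320197, 1319361, 9476, 542469, 9732,
  1328901, 3485889, 1141642246, 3420609, 1320257, 8708, 620097, 1124865030, 1061002, 8452, 4996,
  5514049, 1320453, 5124, 18180, 528899, 795141, 4379133574, 1857217, 5252, 529413, 8459,
  2164531718, 1126593, 5380, 1053701, 1108087814, 962, 579009, 1053573, 3238273542, 5385757958,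
  12427, 4379133702, 791557, 1053443, 4427, 1154, 1282, 1158943878, 12552, 258, 16587, 130, 8267,
  17028, 4232, 8392, 1090, 2232685830, 1328773, 18052, 3305383430, 138, 4346090374, 7, 4312023686,
  796165]

/-- Derivation steps of the refutation of case Five. -/
def stFive : List ℕ := [
  29140751818754, 32439419215874, 32988371312642, 27061185084571650, 775087549306536394754,
  139651175834001410, 85607980372762626, 292775947180228611, 36288718340098, 22557585119518722,
  234220720328949762, 40571984434339842, 76600231697719298, 17597644783618, 4534391485284354,
  3853966606338, 27493450817538, 12100353720322, 279266613483552770, 4403991003138,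
  15948855984130, 29692741066754, 166680471208509442, 198197972235763714, 45085480628322306,
  229734714685104130, 42887437139970, 310779177692938243, 38489323552770, 443158725631266889730,
  13750628179970, 81114827881488386, 15399962722306, 157671073801551874, 193705368357715970,
  20897669578754, 2206024343554, 23096758763522, 13555885905911810, 72117524469465090,
  108132027837317122, 184689922967928834, 301802205145055234, 103642172663250946, 18149628674050,
  959708100339186769922, 90132473494224898, 175698117635178498, 25846330204162,
  180208314466557954, 26396287401986, 67617774139514882, 7154989580290, 9068780095315970,
  63110876111241218, 162198314251427842, 135155825941004290, 207218367782436866, 53884558622722,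
  996678152979685826562, 31894516432898, 6056061853698, 34643450183682, 288300204066635777]

theorem checkFive : check 5 [(4, 0), (0, 1), (1, 2), (2, 3), (3, 1)] axFive stFive = true := by
  decide +kernel

/-- Axiom instances used in the refutation of case One. -/
def axOne : List ℕ := [
  7300, 4379133702, 6493596614, 5385764742, 8749313, 4732673, 6131841, 3543169, 4556801, 4997953,
  4265537, 1447425, 8144449, 3239590278, 4395908998, 27396, 5608449, 3548033, 2723969, 2987009,
  1090, 577793, 2626, 4312019846, 6459509382, 9156, 1125652998, 3394, 5508, 3432769, 6305985,
  6493588422, 3433793, 9230209, 4379131782, 2164800006, 4219329, 3306429830, 793477, 3167809,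
  5470956742, 19396, 8267, 602305, 4524033, 1667905, 1584645, 3437441, 1913217, 551877, 9278273,
  5007105, 922753, 531205, 4998273, 6166209, 3906, 1076869, 12676, 4743489, 8749697, 7919617, 642,
  1414017, 530691, 816385, 1124865030, 19204, 2754, 2492289, 2939009, 6404, 6084481, 3306700166,
  5046529, 1580165, 3781313, 4991041, 7173249, 6418625, 3323468166, 528901, 4868, 669249, 7991617,
  28292, 4741057, 4379125510, 4329059270, 8135489, 5892, 8392, 6619393, 4346104646, 4732609,
  6340801, 7205057, 4994817, 1844353, 1175198726, 3436801, 816833, 2231643398, 2676801,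
  1141644294, 1962241, 3250177, 4305601, 5620801, 792069, 3797185, 4346092422, 834, 18052,
  1125653382, 1579653, 1326917, 1175745, 8204545, 5525633, 841601, 4312019974, 9041409, 1650945,
  1062789, 8138881, 4312023814, 1123585, 1126721, 1410, 5469654662, 543685, 2882, 3457217, 551685,
  8750209, 3238806406, 578817, 3306427910, 6682817, 530949, 1059589, 6578625, 1319361, 3684545,
  537025, 918273, 3510465, 1857665, 6682113, 26756, 541445, 5469654790, 6493838214, 529925,
  1330821, 2306, 16196, 8704577, 811841, 1059525, 14788, 4593153, 2725121, 1108875526, 792965,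
  5124, 6304065, 3543361, 5296513, 570945, 791555, 1175984518, 1348481, 394, 1124877190, 28484,
  322, 1580421, 2434, 798661, 281477, 15748, 1338501, 5009665, 1587137, 1601665, 2498, 4484,
  1141906182, 793475, 793605, 4731713, 4397222598, 1058565, 3420289, 14724, 258, 1326981, 5382529,
  1061893, 5437407046, 1062917, 1338757, 1175985030, 1857537, 1335745, 2164532230, 5385766534,
  6527655174, 10692, 6459501062, 3650, 1103041, 4313336454, 930625, 12804, 796677, 841857, 24776,
  17156, 4207041, 6038337, 19332, 3289388038, 1142430342, 3255316934, 6510619334, 1175984774,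
  275461, 2631617, 1437889, 4732097, 1588035, 6694337, 5470965446, 5366593, 5264961, 14660,
  1055365, 8999745, 27268, 5470961478, 1587653, 277381, 4312023686, 1125652870, 8967425,
  4379129862, 4312548230, 5387075462, 599617, 14340, 6156481, 14852, 1320965, 1076805, 544517,
  6619457, 4995265, 20292, 1583365, 579585, 5570817, 20228, 795141, 1057541, 542469, 6305537,
  6527655046, 2232685830, 2215649990, 3010, 3158337, 4379143814, 1328773, 27908, 537605, 17220,
  3306450246, 529413, 3691713, 1592261, 6493575686, 1124866438, 3544641, 6493334470, 1103105,
  4380169862, 27716, 866241, 1107833862, 793093, 20036, 1584389, 6693185, 2198875078, 281221,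
  8139137, 1331013, 1108089862, 2050, 4232001, 4740, 1124864902, 6459517062, 1058821, 6476819398,
  24712, 9476, 1075845, 6681729, 2818, 2164536326, 10500, 3772545, 11780, 1451521, 1389889,
  1588613, 8266113, 5470965318, 4733121, 1076165, 3305383430, 862145, 881793, 8706177, 9988,
  1141644166, 1175460614, 1426305, 27460, 1583621, 1141904134, 791427, 1319745, 1413569, 551621,
  6510615558, 11972, 1338629, 7365057, 1583813, 3239586310, 656961, 28228, 793989, 4380171910,
  1060549, 1076037, 551173, 6494362502, 1061002, 3465473, 1579781, 6459505030, 194, 8452, 1860417,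
  4379125766, 4380446342, 6510353414, 803717, 2232962758, 4731137, 537093, 4379135750, 2242, 2370,
  1026, 814917, 27332, 1322949, 9011521, 6510619590, 6276, 6459509510, 6476811206, 543429,
  1158943878, 1603521, 1579525, 3714, 2249730502, 3305387398, 1322501, 837761, 6493056518,
  6510373830, 3205249, 8964161, 577729, 796165, 3692225, 1330949, 4329315334, 1061827, 1580293,
  5419847494, 4312025734, 2198619078, 1650817, 19012, 6308673, 652353, 3330, 1108352006, 543493,
  11012, 4732225, 8225089, 1328965, 3306700678, 531717, 8442433, 7044, 1142430470, 1108876294,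
  5632193, 3323472326, 3305649670, 552197, 5252, 5260865, 529157, 1175198086, 2215123718,
  1158945926, 1175198598, 17348, 4346354566, 6916, 8459, 1108349958, 6685761, 2164533766,
  6526610694, 1322693, 3323476294, 27140, 9220, 26884, 1057731, 1580037, 6510635974, 272901,
  3255593414, 4397218630, 24714, 813445, 1338949, 6431873, 1579651, 1141904006, 8986817, 1589125,
  6460820102, 1057797, 1076101, 13764, 1154, 1064773, 27524, 3322161670, 6459517190, 1592197,
  2198873030, 3305401734, 1064837, 3238291974, 1055491, 3679041, 24840, 8900, 16587, 1125129094,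
  2384321, 393, 7172, 9040705, 1142430598, 6493596486, 2690, 17284, 4379133574, 1063747, 5007489,
  3306700614, 6526627078, 6493072262, 4380442438, 2164531718, 6169729, 5385768710, 1061829,
  795589, 4395911814, 1158958726, 899265, 1125129222, 1108876038, 4396436294, 4380442502,
  3289922374, 1320453, 796163, 1108875782, 10756, 3323477318, 5470433222, 8417601, 1053573,
  3323476806, 3202, 13252, 6526614918, 1102977, 1063749, 815425, 6631809, 1322181, 792963, 14212,
  1060547, 1158954886, 1677441, 2249730246, 2178, 18180, 1324549, 15172, 1054469, 1588101,
  1421761, 1650881, 2215648006, 3306696198, 4592833, 1141388294, 1108087302, 1108087814,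
  1124867078, 816769, 1175723142, 797125, 2164531462, 1175984390, 1328901, 6527675462, 4345588614,
  2198086150, 6510111686, 770, 19076, 3255331782, 4397210374, 3238291846, 5387070982, 3322162694,
  6568001, 1175984262, 4583617, 3255310854, 2198608902, 6476798470, 3246145, 706, 1388737, 9732,
  8459073, 1077061, 2248419590, 6526610950, 1124866950, 27076, 6493055494, 791941, 551429,
  4312033926, 4380446470, 7556, 1141906438, 12228, 3239590790, 386, 6477081542, 1326405,
  3256359430, 3306700102, 8267329, 12427, 1962177, 3306434054, 813957, 1583877, 2248420614,
  1124864390, 1339013, 6493858758, 1175460870, 6459505542, 28036, 3238539782, 6493576198, 1584069,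
  3238273542, 10948, 3238276614, 3323476870, 16520, 7942337, 1666, 884993, 14276, 1075973,
  1324933, 2562, 4232, 795139, 101724298, 5402801606, 8964, 3306432006, 3138, 1175985158, 1322245,
  1320197, 6493838342, 1175984902, 9011393, 1055493, 6459517574, 3255331270, 578, 1055621,
  4346102662, 1330757, 1538, 2231641350, 927233, 282245, 6526619270, 5385766662, 7426369,
  3305385478, 27204, 6526626950, 19268, 1592965, 7812, 5380, 7, 4312025862, 4536321, 4380169990,
  514, 1055749, 3306427782, 3238275590, 1062853, 5007233, 4329060358, 3238277510, 5469650310,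
  1141379846, 282373, 276997, 1339205, 1583555, 11524, 4397210502, 1056389, 530693, 18244,
  1053701, 17028, 1141642246, 1591941, 13828, 4346104710, 6477061126, 5387074950, 5419845446,
  3322420230, 4996, 1175984646, 1125653510, 814469, 2249738950, 4380192326, 2198871046, 1592069,
  2114, 2214867974, 276485, 2164542214, 24904, 27588, 274949, 529411, 6660, 138, 3238278022,
  4380180358, 1593093, 898, 1324997, 531461, 6788, 528899, 11204, 27780, 6459500806, 4379129734,
  4397222470, 1053315, 271365, 539077, 813573, 3458, 1330885, 13700, 1580677, 6532, 5436894790,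
  10244, 20100, 530947, 4346102598, 797637, 5402802118, 1585290, 3305387526, 1054341, 1326469,
  814021, 4313332614, 4312021894, 12552, 13188, 805701, 8708, 4427, 12426, 4395911942, 3239590406,
  278405, 1579397, 6510635590, 5636, 6476798982, 20164, 541637, 130, 11460, 16260, 1141904390,
  15684, 798213, 1125400454, 806725, 4312537990, 1593157, 2164534022, 5470960966, 6476557254,
  1141906054, 277893, 10436, 814405, 15236, 4379392006, 4312034054, 4379135622, 279429, 530181,
  544453, 1587589, 962, 529669, 1592003, 450, 3306450758, 1055363, 1592133, 1142430726, 1061765,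
  276869, 5385764230, 1282, 6527655302, 6526619398, 1053443, 791557, 1587523, 8750785, 4395903750,
  6459501318, 1794, 1141908486, 1063813, 1324485, 1320709, 1125127174, 795653, 795587, 4380446278,
  271109, 1325061, 27972, 797189, 4612, 1579909, 6493575558, 13316, 7428, 6493576070, 2946,
  2214863878, 27012, 5385760262, 5764, 12740, 1324421, 4346092550, 5470957254, 6510635718,
  3323468806, 5470957510, 4397210246, 19140, 5420117830, 4346878854, 1108351750, 5385768582,
  3323468294]

/-- Derivation steps of the refutation of case One. -/
def stOne : List ℕ := [
  1715883025553571843, 2476991484803203075, 176504791427785835263827973, 50617265905666,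
  2693250445074350083, 335929930047490, 340301735469058, 187716764719932583256342532,
  288692764615786498, 1072320199290060802, 1522680711780900866, 460739231760386,
  784088736580984834, 1423601532930908162, 86032443668914178, 739053839886712834,
  648982397157285890, 233153463435266, 1022513985068302338, 1225328250864041986, 41838876459010,
  254044587073538, 317816278466562, 261191546142722, 189173833203714, 273286456164354,
  312319105294338, 2968344417605402627, 2999872348200861699, 386534979829762, 770579588371423234,
  1220947797483732994, 2882776060050587650, 3224958979412197379, 3287725659846426627,
  27046714803362084962307, 404127943622658, 406851248791554, 90548689564467202,
  540898206935818242, 1166791352758304770, 13064096304675225796610, 2905305053743849474,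
  77042288933216258, 31989250288164866, 1495657479920263170, 1302012591585247234, 479446227566594,
  153441285898242, 62181887877122, 227108654006274, 3355644123673182210, 50020691907125250,
  1779384257115594754, 2409889854210777090, 475598478786562, 131077239145218050, 85272187600898,
  98466344894466, 3378048931217047555, 27711043083238185025540, 414575378235394,
  2463938538333323266, 197422756724738, 108912137773058, 144096536690690, 146295543382018,
  146845301571586, 345307155120130, 1396594232866701314, 107263295062018, 162238890639362,
  216664699650050, 228811087380862513139425285, 3445723413554446339, 3481768139526406147,
  426670005534722, 429416707489794, 2936824756275560450, 60534652387330, 219414099165186,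
  293081364037634, 432167582040066, 3562845995268153346, 396801713687281666, 626489142971482114,
  1464160322929868802, 1901008937029107714, 2954844652766248962, 4044736653425033218,
  444810268295170, 2806240159162761218, 327716862296066, 442066062131202, 443165566648322,
  12142110418598101843970, 119909425954818, 30146117992202156163076, 3693420271385755651,
  3702423093152890883, 3706948536142249986, 398086218612738, 427223258988546,
  3361478259958782672898, 453056257703938, 134203685371906, 272742136283138, 384892318138370,
  430522040672258, 441517175881730, 3729455596234506243, 16713363567645957390340,
  788176692826587139, 11055460711945600237281092684365826, 4975353962283010, 191378969706498,
  228212608040962, 370049611595778, 9054795417845137999093474092404633277452828677,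
  962901112777633041638191525478794482919615755902120419333,
  46773070874866822320406965066742963491521805991938,
  20441976828657342991627041303418505376192827520299004832088070, 111834751785279807718326276,
  19381091392138401509750252649038387673275451534919527446425542301048553477,
  1510745942040559196337899563279202404663423684017684956545386615079199540299894207680316138622521559538667417785077738173491506403999749,
  22392204585532158950588722243273501003135454900596472380485085973983569552104977818017797,
  45693181472070555079361976062379025817239039069504668560484806677164076940302018577838382293450512823571003583993446193609553009912665629603804887978444594554445483843521707340758588425315576069987108441464009411182596,
  101410215778458638284349484219164853729459891290050628731593823263106296201430078318399150784310510542701025511254064503963704275223966857666564,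
  905181008022558049331368793009662451793926,
  1118375371122683552293574101759667177888260443326228178893645708808873905335570306068613881577040058456362824185812494483289940609123547639904422476054584294884818961208108396677543892933869163880517211026422835263181331058083764510681397423065249857539,
  259592318013269744501028536219439367802106416812080653380523104100220233642835971,
  69584447464802883299705864561816695821640924320124048679230058915898983167016770039724194469910758303721951474142404399642525021004065734888414278553522705343047647247,
  213712171859010089655255043,
  65783890643574139431470307385924300188418890988928764726863738283463069351757434756491648290044957070770158132028904572794757567346602680331,
  34283873175296636301615151976397889150338692528590880840202546709091732564307997441763058408122632393113883441985936041280596384815602714605018667905882775323954075076947991574584911385737115875213851258520918633844388763546297341989405016069,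
  20084697125346127549039169860905909026658247011348972914488010297867550324126757473436852756246019455341768616956542816047877049832298017291015809478972905963718426250764992084385678791032512079412612679712945026465895411901535098288849450962232030031182895188882630119463253136975753470259375381927058133292232392282676749838690084378226043482571828632915412023094091908134681448158063600392135358994733643055658813206492900653512251570609456774187279990489093,
  7485565975912807377436223475843075, 93987398212119835329564206080706201812996,
  456019247120044223873222786342129453080579, 14623703984576100500500849911152646,
  371656145468380663978141834098757946048518,
  1346840634965560391545331274841933033370979913957843219668739774117283087598678039293968883175747797723418836582397640714,
  7481938770332195846064586657291841443019240509290532023584354360163781228961450511196219461769812768176543350795,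
  82826805393109745638415523874531007261181518773311123197115292607861798053171194185638837837493918154393987326175226842169006928367958147711499718666370080814557603519447712802687145494004002699757185713550750335289671296434703037646951286003915844530037439908252025896856322226312953049590186559455674644842785055795089527478556187592916401984080485353091311266524543188062410688206854878586817508984374432142506127588497769570287506271653267833270281397838099705958877372421,
  1526965262871256157920980095216718233041311372390747657093600010890287431811803327801467696658653997320785668754062110518932742081830865493642433806743401033209482949863669956122334538030169428719059087832407125224727606714104960495932821105190317204475062453070719998802634740962836947973194114252954892598554692643695785741297100716422001498503471108,
  930392987215455175904461480861987760729200487951497557587340777236964573407968570479655515213035282115281012792212540844434318278659,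
  178017805921415122818585540174873429782515714658999850531909013418552929458468917025888300943943433566061096899972702963824933681864721983839972156490304503166067576795052784700167791614392665639118965884159703971492032396691365844526212662065566760506114380862575674508942170878401100350166003318787,
  112345210887439625590856476582210029423294480646265530961934188547,
  645578854911480328024586830371280943310738915486006441410096230870436200347924227852738817683857644718344079960175749550200937201345055128812758808290097405954,
  3216066079904284674, 1419130378382802946, 78131682181122, 344763256651778, 446468075110402,
  24759624845712031809538, 417881050660866,
  282033616936810319079102357490076556359833402957752437209744094472699845196006042288333033525287418701936781031374956591543793404956205264060419,
  503688856369545922286536916167395003146244, 1851948733001454248375999632009339213602078723,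
  240506855058778235802879144959621086916742023250887476351637329678713858248442540774304362748768350737169327123906153784324898435758085478287263245385678851,
  5332208568134604578130048996287664831410777069716092811307970663103030649836867134587441073405955,
  2647065315725379040613411377850933067404217764513727818798435160113995634897976600847637852126359813073158146,
  297706034403147778, 459857611221155842, 1000281320168226818, 1004787668574863362,
  1518179334397378562, 2130670532986945538, 2342335867182596098, 2450435452379365378,
  2436967534480834562, 405866092738871298,
  374226334331703879643844397879394626634761080963961316466598866753190301544530235360648346905036408385932644427418133450493682535443578762153199478650152030240520422999207921039084403262206845875155663530633319729983111172,
  275005832660564749419448042108916954566661378189091672530766604432944432848607829301922227863600772003960629788083113673489574209553767179872749007026760753154835206232090489624707076,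
  6349619812938054854193767855669254,
  276085858558842672873151387535651951427984154159206539670617420593196875022126063188000632987992923044813918382692515301728792573147660450646331155590020225835055080721722156521399765606587613188,
  30417849278321071702861917392906830170138707391277135368217682816809513975136006207588042769327284228,
  24938042612284628125628441611326728452895855591428,
  240131454735406815118778697693388759706137735832110688803758180044367343893115136984138947657908439812953767037804548,
  101232528193057746708891767054578775175064145771839582923127480323,
  10332388436780513333815724246422439095403578212272180378871846695371009298400274690183994432121963190612048231237159123011203860193385389636249709185298540371604404058818245103898720624584875798151071313960582646676132808641509016314433203064810282054097937308269962265369736543280513070768130,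
  657995104103538690, 883265795182116866, 437408882452668418, 793121235102744578,
  149178506368131074, 207725301591089154, 1045388236218408962, 2671183853406289922,
  1347131060520263682, 462962876858370, 1374085588241203202, 2184748364696420354, 522336813293570,
  96276056866818, 1378516620583157762, 2099173375068258306, 103972858478594, 256805141676034,
  2918804868026384386, 2207270211763486722, 383798838804482, 946262316166430722,
  230236704602685442, 83082475929602, 45149466099714, 282094225457154, 322226386378754,
  411836611723266, 4211390188457345026, 4553700044098486274, 101225054191618, 171044037820418,
  193584022618114, 248009849389058, 290890777468930, 3661980720929095682, 3090035113192833026,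
  3211636701517512706, 1995663152992878594, 2513568314206765058, 210627260088322, 371705699368962,
  154552219959298, 447572086521858, 3184611255861649410, 31956765868034, 232617634365442,
  378852682055682, 2319877246523711490, 188087480598530, 338720568868866, 395895171137538,
  707608371200040962, 3698033708213534722, 6165986912439321149442, 10224171540459008688130,
  171625590422650882, 1572239576979095554, 2112749597587193858, 1239052919147118594,
  2121755147834671106, 112222186094594, 252959669714946, 318380607995906, 244713400336386,
  15020117822496364929026, 21476045851053501169666, 24021890189108975353858,
  22251637826603279777794, 16274847717872271097858, 2909815814273417218,
  33561778406894549802788892275656690699108730512724883712607626073893381754925075249188420851313308300157645817890327748916708115865124612390585950405391563227235224220442195050498,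
  1311107216133881858,
  45681925577600566921351748200773096144973508421905933902363552958755046972954990879228182189148306231407386793870391551031968411772075106693879183732785578960198415055816164845995516993504933047222044185861309750919171,
  8459188579971514221830290050301955,
  776074776637840295387175294030210785945859007833814780354470516058182807358018959239527631300805913116833147937588574359867878840960196595118824224335707381491507367388347683778985989,
  333653777448593259590768948788807669594524325437448227479470254104640008691539972,
  6357604570217187699811740008695486758468464201877990508964619106921909792135330916780055735644422977246694947618457324412247311959440996474753069731796249932926106555482657612723534807044,
  9740219125242548649987, 12233447886339932230333949730872531340012208131,
  13733895037070354089093988616175618,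
  3740556249274608645311158340348096171262041656597839412275231151246637593055982955588844629223892415977773824192652663527763718273834279477332900953649485159464963,
  3127112299627359167315290477380161006683832333625723122946401707230994162267249039840534490113736612686167963854247744928509460799825273857267966839833082970114,
  389850814185474,
  1412495037946776211196658264114895851485401204568164788753488985845530805455786602124216216877211879441898887133305378984330131619306994846941439924583161931981908667091795279001488040384919718960304050749140332439384935759955161345605310935344185347,
  47110274333714056189889567283554979584153611868091792182212748594245622786160342732721625810676643892178619796928338808581456422355295742943083925547308598370182943945013035089930,
  35198537758441462511340823316606075566756959942123522, 347267077898133506, 486870420013555714,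
  2801759111487520770, 3080949852862234626, 2076680121353617410, 3040418006085599234,
  363463129300994, 420088063066114, 15821765196321769730767870614994949,
  42832007721143909181137916150637524601382768265348267039457419640968866645988027645106003432855009801738822403938386185538863109,
  18885887151064182481730491366845953003154872137306467915636742,
  20391938148676528385121724801748191009063164715091143298091553949345919672959102660661208872092653305479037897148850806907213449284183908426085146840896023621503209311650698262100917617316038560672125803690985370265420894061845920791999136583231846981643,
  79764694336150555459169881126085443586,
  398693226568516528864258941436020026406032868855316040124075330258829445642635729016309046773534397415431,
  211639994264128053238789807285802307098096682615704433515730206409114721371226159939969256369304669470033904098094224903120372495610686840909833794964907738979821943203227870982230924856827404299,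
  2645346930186399648084086776548237457065177925841148923878179199295311534409220505768293151932420,
  1017865157907163890292540549913879776159567440259721431205302838935557,
  266215597035184715964207233096141305180939272744729560370248501300349454814225037851130467280601394135512021798009598999750420342880681829871853492502740489059525286346548674662464519119363961489571461672361885924571606817630379750266338668771919274559621016353011079962890414994325088005622498805191606819308258804262536673470884697648972125618179,
  138002167647367182255623945666191855300464710517792262215621006896938416332346630531949412884904606311565623666768946932618317591581678826946085993903226521588496707294551572691533827,
  316970368711122869160398992229611552955004667686446322636809632893964779386025172513181903573461519994912770,
  327180261343234, 329379291709442, 3177695446092192874498,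
  302366977768785935455246326323948749996485891139960836,
  38464656243178026692591026793590622434334576683681621309314527430360917587098261442130654554511399946084236521105405689638074972849364227861113853116421,
  188916428770337312751779844, 61658201575474777800994684521526575109,
  148600397270699068196316096882781738502203946115635988790078658531174437609477,
  129150945637578391126890539832309350408002542888434665123328127726829111787524,
  1840103199068116939753207149259976681239699655747997171007095875895300,
  266479982868190343796022998621035114876909917525147655, 15274442088321917756217616320724997,
  436769846244074809112673696532332676255901813716304893073603037326439791224733352025065481804692430749705,
  22969244451496505573854507142995715836725971713023139813341126236280479751,
  1261140249112899573161194060071573785964466280513343646440620044961083801865919396646468448270121182968911336140843322677977624190359713952149475147914501345222836467871352935918773738696666055555440246055241328459504277177615869450494112577887931977081045393727839672741089339259886411780,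
  12515250597249712312671711928358727365901231056707499390209557971493206043152597182867132064826596301331595976708,
  466089870374099134999261045421778314497670957982749918237210001411,
  9768757544481348236782403493921671724877010774016751402367612610061886312711212154844967935951663601260422267814241109216566410453586274326344212663561448836873438129515821964042005534638423842696397314441187862021393788236126026687786258328071104258052,
  1956224627378797051907,
  13309982879944976780448000422417145037659200047702896690885919097874977018201094651254353800513042378267194398475789720503041658101403934889307700197749472407017391463641752748326511959444657969197750697083427112541604878514080866312490435316121491898581706927469532430881118449728166319093089380632359831963051199908225835707808811046147816253464763867138,
  153694759990173698, 2252350196104527874, 329314254732492802, 461322091020290, 159506320162818,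
  141364480475138, 343674584899586, 423938966437890, 1261638542950449154, 3112618539557896194,
  3653053793409662978, 1563381917176922114, 314537966862338, 204586871177218,
  20750357632142963017488301694602090882280682321935801914171349273582774858864193551666615062109719958151651410250198529222112306677503845188127240826891657366384042261420190656156931608161268342654528161260300617247076863621108871429055248756576281820174043767572786694448012328067679229745105745665206253535017326632702154223542275,
  117507383500946268078426171260997498043722683845205669040568359796097631572924903899162476161673715454478118035367466171755266732148241254658949091816677220429388524856081599705084746454793238329502942795923156767932103695954829754850816287928197261658802560251188477954,
  172323217171096808417312770032726806754359487866130862939288311889296718048419511928594883477798377090449080092459354886092537791140065228520734336527672637851837038594,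
  3671008269162364930, 3265684852497432578, 77593735036930, 5107720871900790786,
  41805555892137555099650, 361817629786114, 193042660753410, 203487991996418,
  145111058964795041979801602, 131470205935618, 1356132772506861570, 3720524226143141890,
  473477273321340930, 41768662403990515146754, 1981965445240004610, 22805427470483656204290,
  10077205601314199461890, 432983909654396930, 604043179919540226, 1554330738890244098,
  662678485766701058, 2175726332468019202, 18784091252284750864386, 2378282213224022018,
  1500341419943362562, 245820397805570, 423391592415234, 27567504097282, 368416145702914,
  202939712430082, 300246516908034, 178200865570818, 950912711393075202, 25793908146844811796482,
  1896670832255246338, 14157941759918082, 2554189780919345154, 1387766273535475714,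
  3513467496744738818, 1757061443101270017]

theorem checkOne : check 6 [(4, 0), (0, 1), (1, 2), (2, 3), (3, 1)] axOne stOne = true := by
  decide +kernel

/-- Axiom instances used in the refutation of case Two. -/
def axTwo : List ℕ := [
  1626369, 1141906438, 6590785, 541445, 15748, 1142430470, 962, 814469, 6526619398, 7917825,
  1078273, 1125129222, 1282, 549313, 1922, 6788, 795653, 1587589, 1055493, 4740, 5005441, 817089,
  890049, 793477, 6510635590, 1158943878, 4993345, 8587, 1324933, 796165, 8151233, 1108351750,
  1114497, 6459505542, 6582593, 6526626950, 4997441, 1582273, 7044, 1415169, 6459517062, 2114,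
  1591941, 2416961, 1057541, 552453, 6685441, 531717, 1857281, 1125129094, 1125652998, 7205313,
  16776, 3425793, 9277569, 6509838214, 3428545, 18180, 3238273542, 5608449, 26884, 2370, 791429,
  28036, 1888513, 1324421, 9184449, 3425985, 1141904006, 550849, 1142430342, 1175198086,
  1108349702, 4346878854, 1108087302, 2626, 529925, 6693185, 579777, 6459505030, 530693, 8179969,
  1058565, 4312015622, 8135489, 1338885, 815425, 1175198726, 531205, 1592965, 604289, 1058821,
  27204, 1108875782, 1579909, 790915, 793605, 840129, 1589697, 531461, 796677, 14724, 10436,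
  543493, 4868, 4994497, 2231641350, 2242, 2164550150, 17028, 18052, 795841, 1579781, 12740,
  3305401734, 12427, 1588101, 5124, 1078849, 1856321, 2249730246, 913537, 1141906054, 8964, 834,
  1108089862, 7172, 570945, 16260, 1057797, 5385766662, 4380170118, 13700, 793093, 1141906182,
  8452, 7356865, 4346354566, 811841, 6563009, 530181, 6526619270, 4379125766, 1175198598, 542469,
  1055749, 529157, 1053701, 1141382150, 4207041, 544517, 553281, 3432577, 1593093, 1108349958,
  27780, 1055621, 6527655174, 3305401862, 3306427910, 101724298, 5252, 813445, 28164, 6527655046,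
  17156, 1421761, 5892, 7094721, 5385766534, 1054597, 1175460742, 8144065, 577729, 1857025,
  1414465, 3416449, 9732, 1077377, 1124864902, 1651137, 1330949, 815233, 8267, 7991745,
  1124866438, 1326469, 1328901, 6526614918, 6916, 1175460870, 642, 6459517190, 6459509382, 10500,
  2498, 2882, 5636, 4379129734, 3238277510, 4312019846, 1175984646, 4993473, 3238291846, 6431041,
  19204, 815937, 4484, 1124866566, 552197, 814597, 12552, 1175984902, 1108089350, 3330, 386, 4427,
  9988, 1108087814, 1062789, 551429, 1326981, 2178, 4996, 20100, 4312023814, 9228545, 4345571334,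
  1175985158, 5607553, 2754, 1580165, 6532, 529669, 1124866950, 2306, 6526615430, 17220, 792453,
  194, 1054469, 1328773, 1592069, 1154, 12804, 1320197, 1413313, 258, 792069, 1141644294,
  1108876038, 11524, 578, 16587, 26756, 274949, 3010, 12426, 4380169862, 1141906310, 1175984518,
  5385764742, 528899, 1666, 1053573, 1589125, 7, 528901, 1124864390, 1588613, 14212, 1583365,
  3202, 1108352006, 1063813, 1320453, 3306427782, 1579525, 1320965, 9476, 1794, 1141904134, 7428,
  1055365, 4612, 1175984390, 1141642246, 1175460614, 3305387398, 1142430726, 6509837190, 19076,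
  4346090374, 27140, 24843, 1175984262, 1125653510, 529413, 10244, 3238291974, 770, 791941,
  1338757, 15236, 1584389, 795141, 1579397, 813573, 1580037, 1061765, 791557, 1580293, 1125127046,
  5508, 602369, 1124867078, 138, 9220, 6459509510, 792965, 1124865030, 5764, 2232685830, 5380,
  1064837, 6526610694, 530949, 1538, 1054341, 1125127174, 551173, 130, 8708, 27908, 6660, 1061002,
  4346102598, 1090, 3305383430, 1330821, 4345570310, 450, 1338629, 4312023686, 1175198214,
  6526627078, 898, 514, 4232, 706, 793475, 272645, 1338501, 20228, 4380169990, 27012, 1125652870,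
  1322245, 2164531462, 13188, 6404, 4379125510, 1410, 8392, 6020, 1320709, 7300, 322, 12676,
  2164531718, 537093, 24712, 1579395, 1141644166, 6276, 4312015878, 3255316934, 1108876294,
  1141904390]

/-- Derivation steps of the refutation of case Two. -/
def stTwo : List ℕ := [
  544958702081867779, 38992172401007561217417221, 116565280890882, 792843559058800642,
  270426010075013122, 29156858159106, 351427581576871938, 923450155206139906, 112729104927981570,
  51153354194946, 41807572426754, 1333088607745769475, 90368263315651423306031109,
  12397932581727681593348, 1517924358261391363, 117240397834371074, 89086972772354,
  127569980456962, 128669474324482, 134167016677378, 166052870864898, 180896280215554,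
  1549420807824457731, 191877128069122, 157772798805811202, 684769271754694658,
  788342167580008450, 1036038497817731074, 174299640659970, 576682331277598722,
  1454882059629641730, 482104540184756226, 1459385109619720194, 132518843514882, 136916887650306,
  171551520489474, 106999340461147068422660101, 1617014939640184834, 74794796646402,
  24767097307138, 135268020633602, 136367514886146, 149561681248258, 168253362356226,
  1261233873512103938, 58773323028471810, 16521169813506, 45658230325250, 167704035196930,
  1630536719291432963, 200118903463938, 13657612543737858, 198395357221838850,
  48674134049308126298734594, 1162150284314198018, 1770136234009231362, 247919560157667330,
  743313320200519682, 711802416461266946, 752322718489976834, 1247716478516609026,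
  720809615766601730, 220897962527465474, 1166651685293408258, 1599011543173316610,
  1468407154060869634, 1526953949401497602, 1414350214871105538, 235874949840898,
  1450379561847603202, 42361236455426, 94038286532610, 77545745121282, 131421816078338,
  7306896968253782278146, 6200105834080470089730, 13468154546645537636355, 1653039345655726082,
  26419005456386, 10442726380388773576706, 216628521680898, 130872776261634, 68750436376578,
  1666554691370401795, 204511044362242, 180290801038524418, 211924850085396482, 208938529783810,
  56656213278722, 59405059514370, 193545501720578, 878433955856580610, 196844247433218,
  9299086798463167430658, 1698094570167697410, 62703994257410, 140769396932610, 188048386908162,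
  8098190398140852387676954810036700997280969782938897676807051080296608597670544875552591286529383792808172743587795395526660,
  349855803127550319278549722564840095744006, 4685949712708592390055256750817285,
  105791413508839493341806596, 6653194893891511560510206816075779,
  726270833198384345050190877775783874621665467547580541214888918300538247010172933,
  11818999704859578609157084806043425405644407488592201444866718998691310047541373624617537866431887365443505188785636866007008374363389796359,
  349824901112538817375920715044273666113542, 3996560742098469863823782052478981,
  399293741190775227760325213682378954764832638715909044694697853701467498927667056998938951684,
  5084599294567476674295357474102504843937647979631132829835289649907127962474818314249,
  9112948424387423911939, 3976206525628077165050490234585093,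
  114907819606824130544679579440588052939695745517645334911830074464927044056227845,
  21107376700842318451313452026734182406,
  2073202307755282299682472991778517409168706435725215098995195913,
  16262283874263434426041582425501168486124710772739,
  1604866873549953877543518127202176264485696191570247898259383937751857552580298302901863927519402429887856108426606814550673159261883495149534879752,
  440853850888654966293537939459, 2582607443393478549507,
  9590885143665613193197067743179710398468, 9581247368710983280275659945049114525700,
  5770304590907966802097208061189656844206517037845560640694006958996839367300599881178860293582088372774379722629491170521639648841549414404,
  24495780336212332860577410180848612006353494712083582239094602112463391969248460965314563,
  20768550388093011267370143843903686460054638959694252764680191505720127748844533569732677671184925792406432925685567417399605083674322961114358788574914218813947790644887961714691,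
  11417631321880011673537827813201851661743812941883002420641533427660745368290213488143708632526545417431877533322145969345425462597017771707288126158805796206367013366687660189059253140045827,
  718738161662991859043980732219391188693979169736354950568830295072394568749389997614149157175293065030740655514097983490,
  177537082491676240014979435739501329249527020647876934867593877613838431982790795419641398656251364802864881954431357858747177436612476124316639708203009966220700715933961242188231900667250411791650063157265224699103382013683756164850941464633347,
  21672007140097197267453544401794595855655154219376568968679580010054923905424162855895835762801341899148837714166706172472827410946355855891516110088942405569773478282808833901612525703563890792839506055324675143113686233881805380760849530883,
  6496168412224115769590270707889221324624215987824197523190423313990870265384188097684348329242733111180870291213811904241591334738103621576987515469555629103521795,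
  7096269196200772931982893689041419134836182588761990908950603593904062468,
  9653502900464722357478013246585400243497312256993048444536697341777636692673825791458814654114379984296911392715295958238141321466391001485350822137386579184712170750489048765286246252590659568743795374266998733029120181547926680674891155164167853223273021443,
  1903161170558516405466933687899566174774963073023145655565195107634769100917971429554245199237903419869079744320639666066836264042539251756284940527021119917073169485155061743619,
  660601796046028553218675009013729461385234344690050756377970947162115,
  958615723476222081670999482535664950402842425408559808300202345194696401843728908982112286350394288744725492410689995855829986137446400772203717486574602967800873216630787,
  114946497573098307943357500977113829741126787098744808414686063978182434463383555,
  282058624180226, 276561669021698, 689333352037883906, 265943859872448514, 280410156974082,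
  1499931257340887042, 272713714089986, 301980903467548674, 410050801849925634,
  617236175918333954, 761349714726731778, 504680270092943362, 45313108169367554,
  243471491840761858, 477658672530956290, 306521886757888002, 441636472715812866,
  1301759680420528130, 900902480002695170, 202895619014658, 9931423318018, 36319692931074,
  118783046557698, 170460106784770, 599270706704039938, 905500638037426178, 360570580697890818,
  120982428516354, 148470233399298, 1635052441712238594, 1621591120919674882, 459660767860113410,
  851469537630240770, 896506633401417730, 15979470733314, 64357991809026, 102840970592258,
  151219477479426, 10000603558001004003330, 186926704138227302402, 146272154386434,
  178707814481922, 14058914263171062374402, 122083128909826, 11218093175963721146370,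
  1310837250348056578, 153404999288209410, 1563048175378759681]

theorem checkTwo : check 6 [(4, 0), (0, 1), (1, 2), (2, 3), (3, 5), (5, 1)] axTwo stTwo = true := by
  decide +kernel

/-- Axiom instances used in the refutation of case Three. -/
def axThree : List ℕ := [
  5525633, 543493, 1061763, 6689857, 5293185, 3723457, 8139137, 3714, 4539137, 3306700614,
  4993153, 5292673, 8009025, 24843, 1063813, 5040001, 8401793, 530949, 529413, 823553, 5124, 386,
  1323905, 4329060358, 3692161, 6510620358, 537093, 7996033, 3255332294, 1175984518, 4739649,
  6377793, 5470961030, 2921729, 8935297, 6660, 5617857, 9015873, 6526626950, 6459779590, 4558977,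
  1320901, 8934913, 3457921, 1175198214, 5420101574, 544517, 4510465, 6493858694, 843905,
  6459517446, 5527297, 10948, 1937985, 7418753, 1125149574, 3707649, 2626, 1131073, 1655617,
  531461, 3305383430, 7906177, 4380178438, 5034369, 3424577, 2164797958, 5385776518, 7419009,
  13636, 9277569, 5543169, 1441985, 1128513, 4740, 6532, 1434497, 1326405, 2413825, 6527397830,
  14148, 8447681, 6131841, 7172, 1338821, 1593093, 2198606342, 3322681862, 3394, 1175992710,
  7222401, 2381377, 289285, 2442689, 1338565, 6607233, 5470179142, 1593029, 27588, 2376129,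
  2438849, 1125129094, 6510615558, 4993921, 7, 898, 6691009, 1474, 1328773, 8675777, 6313537,
  8267, 4731777, 5358273, 2164531718, 1103361, 1054469, 3306427910, 2198094854, 6527655174,
  2198875078, 1986, 791941, 1426305, 7095169, 551429, 3424833, 1107457, 6476556486, 4612, 17156,
  5527105, 793093, 2376577, 4379133702, 792069, 3255331334, 530693, 798661, 3305649670, 1348417,
  8677569, 770, 27908, 277893, 1338885, 4346102598, 1141906054, 1434945, 5292929, 3906, 2413633,
  27012, 3323477894, 1730, 1090, 8201921, 1592901, 1939521, 276869, 796613, 1422209, 2680897,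
  2198871046, 530181, 1124866950, 8950593, 4395911942, 6072193, 7995585, 3010, 5508, 1583365,
  796165, 289413, 3305401862, 5892, 6526619398, 3138, 6527143750, 2737217, 1322245, 3322949574,
  3323476358, 1326469, 5386038534, 6627649, 3432641, 28228, 1580293, 3323476294, 6582593,
  2198876102, 8200961, 4998849, 5359041, 1579397, 5293377, 1324997, 5292609, 4427, 1106241,
  4380178246, 2679361, 4843713, 1062725, 6526889158, 3305663942, 793475, 3306427782, 1026, 14340,
  5056577, 1579523, 1124887430, 6493588358, 3305649606, 1053573, 1175993222, 2198874054, 1154,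
  8202305, 5385776390, 3305664006, 4280641, 6459771654, 1175994246, 1159216518, 4312025862,
  4208641, 4397219654, 2946, 1175198086, 7119745, 3323227654, 797637, 17220, 5436878790, 6309185,
  6591361, 6308417, 795139, 1124864902, 4346103622, 17028, 4740865, 1061893, 1328965, 553281,
  17412, 13316, 8900, 542405, 4329059270, 6459779334, 6276, 278405, 2414081, 6788, 3306172358,
  2164531462, 6476557510, 1218, 5579649, 1579781, 2232698566, 3255317510, 2215653318, 276485,
  6591809, 2306, 28036, 845697, 5386038790, 1159217030, 5284737, 4380182086, 4396436358,
  4379658054, 541701, 2215651270, 1076165, 2198873030, 791555, 3323477318, 4346102790, 2434,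
  1330821, 4232, 4379391942, 2437377, 27844, 6493071878, 27268, 3650, 1064773, 8446721, 24776,
  5385757958, 4345578502, 1061829, 1583555, 3305401734, 15748, 4345570310, 6333313, 9476,
  1158954886, 14276, 10180, 4329059334, 4328803078, 4346094598, 8708, 18244, 12552, 1320709, 7428,
  813573, 4559873, 12804, 844801, 4380169862, 3289922374, 2249207750, 1325061, 16260, 3266,
  1591941, 3289923398, 5470961542, 4484, 1059781, 1580165, 514, 6346817, 1584069, 552453, 813445,
  2882, 3202, 6526610694, 1322693, 8452, 12676, 7148161, 1338949, 1175984390, 1320645, 281477,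
  9732, 3420481, 194, 7812, 2215668422, 1579139, 101724298, 27460, 2232430534, 1794, 8392,
  4312285958, 6527667782, 19076, 20100, 6510620614, 6527655046, 2471361, 1338629, 845889, 1324549,
  18116, 6493858630, 8964, 1588035, 5764, 12426, 795653, 18052, 4312282118, 2232428230, 19204,
  1056389, 2215649990, 3255332358, 844353, 1064837, 3255317958, 6459517190, 6916, 20164, 2967233,
  551173, 3686849, 2232700614, 1062917, 528901, 2198608902, 6459500806, 1175993734, 3255316934,
  5252, 1063747, 13828, 3330, 5387075462, 1338501, 6459517062, 17284, 6493588294, 26820,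
  4397218630, 4312023814, 1054341, 4346090374, 3289923462, 8430337, 544453, 1584389, 551621,
  26884, 531717, 16776, 1579653, 9220, 1579525, 542469, 4329073606, 4379125510, 1058565,
  3306435910, 1124879238, 793477, 552197, 1858, 2164533510, 1580677, 2215652038, 5385776262,
  1141904006, 15172, 1141926534, 9924, 4329060294, 3306700678, 2164798470, 4380442438, 3306450438,
  1580037, 2232428486, 16196, 4346090502, 6510636614, 1326917, 1583363, 11524, 531205, 258,
  814021, 1538, 1055621, 8262017, 814469, 275461, 1602, 28164, 539077, 7300, 14724, 529669, 450,
  1328901, 6527413830, 275973, 4379133574, 1330949, 2249206726, 20036, 19268, 5385776646,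
  3323468166, 1338757, 13764, 1593157, 277381, 2370, 4379392006, 14788, 1583813, 1346, 791043,
  1331013, 1584837, 4380169990, 15684, 12228, 12740, 8724801, 1320453, 795589, 1592133,
  6476556806, 279429, 3238539782, 1592197, 130, 793605, 2248940038, 6493071750, 3306700102,
  1585093, 5385764742, 3289410374, 6459517318, 578, 28100, 27076, 2215651014, 6527655558, 1063749,
  10500, 27524, 537605, 1592069, 1592965, 1591939, 4996, 1282, 2232685830, 2376897, 813893, 27204,
  1666, 138, 1057541, 16587, 7044, 27780, 1322949, 1124877190, 1158943878, 19332, 4345836550,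
  1579909, 6526619270, 15236, 27140, 795141, 1142439814, 2215652294, 6404, 2114, 1057797, 1053701,
  1175984262, 2178, 289029, 6527397574, 1055749, 13252, 18180, 322, 12427, 274949, 3238277510,
  814597, 1324485, 3778, 2232694726, 6510615302, 290309, 1107833350, 538565, 26756, 529925,
  4312015622, 5636, 9156, 814533, 4312025734, 6476556742, 6527675654, 290053, 1320197, 3238291846,
  1587653, 792965, 3238554118, 12683, 6510635590, 20228, 14660, 11204, 6493589318, 3238540294,
  4312023686, 27332, 5470960966, 6459509510, 17988, 790915, 1061002, 2498, 11972, 1326981, 813957,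
  289669, 9988, 1124864390, 6526627078, 1062853, 834, 5380, 20292, 6526889222, 5470961478, 813509,
  4346102662]

/-- Derivation steps of the refutation of case Three. -/
def stThree : List ℕ := [
  499957306892091395, 594532896650903555, 842230878437933059, 864748858252410883,
  1247582968722079747, 158886947397634, 341989992833026, 1121739946475560962, 1346919512746803203,
  107919652504658048906133509, 1698200130100363267, 1806137554942918659, 232547651706882,
  340341197242370, 194001722322411522, 1941137282209431555, 1963913785376817155,
  2040478820500537347, 140840407775096451572080645, 149910969046946165338415109,
  1175783683869687810, 189158904102914, 95150753841154, 251831133970434, 344740018044930,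
  2346728194833973251, 293611483332610, 294162344280066, 173758810234882, 4847240431411202,
  144462677179064322, 340892026667010, 1013667300866007042, 2436505133274513410, 221045615083522,
  67663827156994, 121539879936002, 183662320451586, 227642771374082, 258429093380098,
  2382758839374069762, 301309167484930, 2499801286699810819, 662387074008432642, 130336576438274,
  136383979438082, 275472209805314, 276571703066626, 198499633684482, 112944627950723074,
  171484276281335810, 243538022024110082, 414388934842662914, 1081232841486589954,
  1216329285435727874, 23172024732478788567042, 345841171349506, 346391291199490,
  157972928122036226, 320098666403700738, 347143903672049666, 671392081730576386,
  1653181198590951426, 184990677649399810, 729949872065355778, 1441507618077745154,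
  946116057144377346, 273274026967042, 2108045311150505986, 774978722202894338, 165522572705794,
  258981046870018, 210602641719298, 232043114889218, 310108347580418, 2544811977345351683,
  311757623934978, 2576438324372078595, 316155805007874, 2594426336014024707,
  21290684432861041704964, 2616970772509491203, 321100383895554, 1382958625657520130,
  95704663277570, 230394854244354, 236442154008578, 322202993852418, 163866762305538,
  18385531139801090, 139980522050576386, 482255743003688962, 716415985582432258, 341445809291266,
  2243184088026529794, 860491041934704642, 2657471810191523842, 292518101090306, 31933912375298,
  96255369592834, 190813378494466, 230945544601602, 291968441139202, 178638599236971419211112453,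
  325503382372354, 42929531666434, 88009499492354, 256784534962178, 267229870120962,
  285921596669954, 2198144794507460610, 2684423571433439235, 2689045234670927875,
  2693552336474505219, 22212794060434215469058, 234542921834864642, 374141865891373058,
  558813090117689346, 1108274234894843906, 1455022818931916802, 1693714699011080194,
  90759346225154, 240292945362946, 2716071552603742211, 22434418759174661668868,
  2743001147207958531, 336495073730562, 2761068904840216578, 64371536953346, 74816895041538,
  104503725555714, 2378286581919358978, 279598160734896130, 531795891576913922,
  540802541092356098, 630879481425723394, 1540603857391894530, 1932448361040363522,
  2225181237307785218, 3148427407370141698, 11735502807481757777922, 6533511997884954624002,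
  2770126145599242243, 2783582639160705027, 383930058292665208435026984965,
  9349929676457975866000311064169147923671735607150361431808111643289016546050439036937,
  4706524335423788361249982174298117, 79501188290713667771400194, 2175620751739437058,
  260635769585666, 335952320266242, 20010392227270547168378213853927819705787764473863,
  1077187366306385539487016239108, 29872874402046600112177748021316063609475894779909,
  6795951734965403284261219582509060, 79496539666275561921970180,
  1560893769322850062853627917607869255262244807534177548327791589079070170131930557624308807400191357724433276562677938252875225232865758693540193000247073892290304218770239013529109299894352122126722677922727143867519327112047177100292393699875539645026225568946636026770042682192770580492,
  446485025916492700355200542264299021795332, 267529249954185591543999856643,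
  852339915628559422237324665271790016525994164625892058482175802926993308186902532,
  4004523321936937510299277150474992757733280547727170221435061182708435332530400085350513649043658054475987215405126899379335753077196357969667242754895208192575713021248503816,
  90075762065699675470923325741816896368155822045135930271317448052318955916173680188269739079926954895280401687152196113002807258277489762467118619610372975058875932680,
  17045791715229053566979,
  6571123111214567099271793550196060887815311888612851316936657438843920391,
  4851024635634463788839572284091523605447606275, 633011277713354937682015980490552249450499,
  6623411872470912061928751791930131970007225245852473680880001923288956337536311473302889247283969256433380101456389364066754450823072978530734509840941469877588901485038105616478995127221625832820169846727621674140057681571933311797457063810042788673977468180634261783226151792130503698720367621992833028,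
  2779315520666380587367658720010073235631576916341186497569897978604640840180182565572597622435347247029258537428315057650648650508305510326468450943673796616539277602002948507548450627591,
  148103707285267077409357826, 1418998973320855554, 266134759014402,
  8794439954816281962206452453690289121613531395264465074797773268318199799599882228902770123734246871284063842506794438242198366528864149203842044189936539937013203849165726882736225010514130390841554721053647713169650647611631431037428766587140288488480811429793243694601226287482123724211055299807983672594118852483649166257647244548655409334668960724351981674781802813169741711360003,
  1539279778480026547128878603590663347271724557367520962283724308942399007407456316057347325431016564436063346537936316758124044212661110500942628605574261205984169481798088291958538430075144554951525674985965304617107316242795243708888149029784610001298561129965194892751250762973951452198620728384849074938007910774337245474148197458862123694511068076519010384830227582229478978608767050631261832514803643115981713623094799022574520822587395,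
  473637059948337898814027887989029814124895203126215574437261979337839423445611194151798018013757963904855209447038230855118460739686674911114950258688919744369387475732242057540891731602914782407967934393799163914715800984076043166166406047280606562617734517664134175430832911117440374740906198034875133180503321426602536097909144561456685859731959857332302882772401194999106770648686209171380106477919351817676037363048308002219400400320392577296386785815563010052,
  28720461766094361028457325184831769508431355542039940023691124028546825632377567437699703329238805368872023906353760254034771880535977447457001122041255603641828108357554027781002231804349834133524693959995931493523314092570152636481870907040826870473184604694444336766869191647235,
  448444635586982738479230711047970143433490289736918638189931031197332330540470107595632408974278314599880451547891655850879494954030846995990937222800109146193009611581080123334971667121450088237131285243067768833003110301608846191316176316515403973694955550605549209429658146715435011,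
  2482978031073194479732368712208943521522612368129172160515,
  448444635586982738479230711047970143433490289736918726681188095913473017428078812035725564639354211124951500422384602576956575002289182963973992786466764709808374586288877279598181281210624090417788744902344098302555217646272920702604061085770450405239706775146630054790193854584561667,
  130159150433115608384123220227509822771746531067077121971701381203044862859840519290684567793237741195270002767552227790844149539755646634265136000500179916007808694985809666719182340092325523179810977693957168166367148636646706925248880300119328250599185100863125441476596264082399234,
  1144293690385465346, 2522394626658779138, 255140354211842,
  1688997511210882643223085829782435510818960184580935288264956689653762520801843256252707990238585207242288636219349620813314914789513272515780243320753909235716,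
  545867748913370045123283619659256183085087034629675982852, 54118247390625008134684674,
  2229679892672462850, 162781739614210, 17157602540863820693506, 851575658119790594,
  37755243299244032509029779738702501721646331763646099304439550629772971776589901433641794032016168518029333318423796598590182009467653294606000132,
  62292853450449393341781087169588807860171586325997522116694200746910722137746364972565324063453626194010079134507637263565791236,
  65815221410015257750361768970958052559169633424615648235799716875264945233923,
  7505541516836661976981503741726255590978281791813464329315773624963720927358371345576104188322687083364855593107605223799892703652226364424247134219159437832029443733528261057527919606704261920703020406210567212475116851392384652976254457876675709928795949443698581122768294327644007428946735510025401136262445375493,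
  2227070760752967373205134562190279525586183825374216863029118826541732645110434596416768514793511988016457700052564231328935806755144741440704064799359505711963115511264091570843809005872615154705336793704037461621068098119437107999843885424645029892,
  6936007389849170067460,
  70389815842114534466011249204465732533100208129546695350064484535588435845538667004892080272126889221132049064254028891592218719323002709477031448816197319753705100985409146254590347324156031273887224129604920224828060128732828636908959290220627489995636739,
  163814353200022506186031745735259123037171751381806106920042863674019636249407759210461261866604769932066349376415041462665625652429940505566819237862334540768486398708936737214085228699548240750111974578913682163050692233765327028228,
  816867344489421146796082166944812342617441803711430995979179228953164442015114159529195269681457538112083088150549652524561107666633965174734535702355326415240569975089507037533966268869639070877945177997086972446181527810797975867601779828112384359343058526214,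
  1769416038656657732265971497909791725043861612619675775730718516703629539881685320711143195807899290435532734475,
  709032337924876544735736019540507751434971239552477816341769855779188125095071566950039616208541070274450234933226634687368175291618501676153820683853639820634624698437806183928738166842637219457694068781726146815609267591806809356387774905033645419897630210239476282434957909797466823480341908242443,
  138584052078616973347694978977608031540191606034687730682538314848867270326829335189455051336152804800898537463458122430564892713856127314225568212847020550657179436123577797061176588787647148845462529073158,
  8520619693952339726744119192995348918133252399156023252319181961738056707323698331831305602738810990496651742994605629123418923519264785380331935440982820434577959470138058299990867772101531470813079097317915807049380621905485070289426986235816727827382684056704999428,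
  220488432978854980811877548035, 16425808447830081646921519275423756646276013042661411851771907,
  30254475437720472043523,
  887507476419121079135009756274604030317111431633952661857790822443353363918954498,
  495786890693222402, 639901529015689218, 707454423914323970, 429414591799298,
  1797289249966440450, 176000531014402050, 2747608145046454274, 1837746880022626306,
  1752253253894455298, 354098402099202, 315615696322562, 100111584706562, 186423306698754,
  216110119452674, 223806709153794, 16826601544482548678658, 1896473445977948162,
  2423392953181339650, 175428594253826, 202916392058882, 238650587021314, 254593506820098,
  1536105211709267970, 5316463788217666240514, 1365045392051847170, 311218759483394,
  14945646140713325404162, 793088239645409282,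
  4769370102241651812379685848318673042211499747130091675651, 257814241054983500707053570,
  3905051573092870834441877542869987359477866494474942472194, 689510946031837186,
  2292785266589188098, 2315305463749263362, 12152147230721]

theorem checkThree : check 6 [(4, 0), (0, 1), (1, 2), (2, 3), (3, 5), (5, 2)] axThree stThree = true := by
  decide +kernel


/-- What the checker assumes about margins `m`, winners `F` and maximal pairs `W`. -/
structure Model (N : ℕ) (facts : List (ℕ × ℕ)) (m : ℕ → ℕ → ℤ) (F : ℕ → ℕ → Prop)
    (W : ℕ → ℕ → ℕ → Prop) : Prop where
  hN : N ≤ 6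
  hN' : 5 ≤ N
  anti : ∀ a b, m b a = - m a b
  inj : ∀ a b c d, a < N → b < N → c < N → d < N → a ≠ b → c ≠ d → m a b = m c d →
    a = c ∧ b = d
  alo : ∀ A, 0 < A → A < 2 ^ N → ∃ x < N, A.testBit x = true ∧ F A x
  amo : ∀ A x y, A < 2 ^ N → x < N → y < N → A.testBit x = true → A.testBit y = true →
    F A x → F A y → x = y
  ex : ∀ A x, A < 2 ^ N → x < N → A.testBit x = true → A ≠ 2 ^ x → F A x →
    ∃ e < N, A.testBit e = true ∧ e ≠ x ∧ W A x e
  wf : ∀ A x e, A < 2 ^ N → x < N → e < N → A.testBit x = true → A.testBit e = true → e ≠ x →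
    W A x e → F (A - 2 ^ e) x
  wg : ∀ A x e c d, A < 2 ^ N → x < N → e < N → c < N → d < N → A.testBit x = true →
    A.testBit e = true → A.testBit c = true → A.testBit d = true → e ≠ x → c ≠ d →
    ¬ (c = x ∧ d = e) → W A x e → F (A - 2 ^ d) c → m c d < m x e
  top0 : m 0 4 < m 4 0
  top : ∀ x d, x < N → d < N → x ≠ d → ¬ (x = 0 ∧ d = 4) → F (2 ^ N - 1 - 2 ^ d) x →
    m x d < m 0 4
  notw : ∀ d, d < N → d ≠ 0 → d ≠ 4 → ¬ F (2 ^ N - 1 - 2 ^ d) 0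
  path : ∀ q : List ℕ, q.Nodup → (∀ x ∈ q, x < N ∧ x ≠ 0 ∧ x ≠ 4) →
    ∃ e ∈ (0 :: q).zip (q ++ [4]), m e.1 e.2 ≤ m 4 0
  fact : ∀ p ∈ facts, F (2 ^ N - 1 - 2 ^ p.1) p.2

section sound

variable {N : ℕ} {facts : List (ℕ × ℕ)} {m : ℕ → ℕ → ℤ} {F : ℕ → ℕ → Prop}
  {W : ℕ → ℕ → ℕ → Prop}

/-- Meaning of variables. -/
def val (m : ℕ → ℕ → ℤ) (F : ℕ → ℕ → Prop) (W : ℕ → ℕ → ℕ → Prop) (v : ℕ) : Prop :=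
  if v < 1296 then m (v % 36 / 6) (v % 36 % 6) < m (v / 36 / 6) (v / 36 % 6)
  else if v < 1680 then F ((v - 1296) / 6) ((v - 1296) % 6)
  else W ((v - 1680) / 36) ((v - 1680) / 6 % 6) ((v - 1680) % 6)

/-- Meaning of literals. -/
def litv (m : ℕ → ℕ → ℤ) (F : ℕ → ℕ → Prop) (W : ℕ → ℕ → ℕ → Prop) (l : ℕ) : Prop :=
  if l % 2 = 0 then val m F W (l / 2) else ¬ val m F W (l / 2)

/-- Meaning of clauses. -/
def Cl (m : ℕ → ℕ → ℤ) (F : ℕ → ℕ → Prop) (W : ℕ → ℕ → ℕ → Prop) (C : List ℕ) : Prop :=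
  ∃ l ∈ C, litv m F W l

theorem litv_even (v : ℕ) : litv m F W (2 * v) ↔ val m F W v := by
  unfold litv
  rw [if_pos (by omega), show 2 * v / 2 = v by omega]

theorem litv_odd (v : ℕ) : litv m F W (2 * v + 1) ↔ ¬ val m F W v := by
  unfold litv
  rw [if_neg (by omega), show (2 * v + 1) / 2 = v by omega]

theorem beqF {a b : ℕ} : Nat.beq a b = false ↔ a ≠ b := by
  rw [← Bool.not_eq_true, Nat.beq_eq]

theorem del_lt {A d : ℕ} (h : A < 64) : del A d < 64 := (Nat.sub_le _ _).trans_lt h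

theorem litv_opp (l : ℕ) : litv m F W (opp l) ↔ ¬ litv m F W l := by
  rcases Nat.even_or_odd' l with ⟨k, rfl | rfl⟩
  · have : opp (2 * k) = 2 * k + 1 := by simp [opp]
    rw [this, litv_odd, litv_even]
  · have : opp (2 * k + 1) = 2 * k := by
      have h : Nat.beq ((2 * k + 1) % 2) 0 = false := beqF.2 (by omega)
      rw [opp, h]; rfl
    rw [this, litv_odd, litv_even, not_not]

theorem val_gt (e f : ℕ) (he : e < 36) (hf : f < 36) :
    val m F W (e * 36 + f) ↔ m (f / 6) (f % 6) < m (e / 6) (e % 6) := by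
  unfold val
  rw [if_pos (by omega), show (e * 36 + f) % 36 = f by omega, show (e * 36 + f) / 36 = e by omega]

theorem litv_f (A x : ℕ) (hA : A < 64) (hx : x < 6) : litv m F W (fLit A x) ↔ F A x := by
  unfold fLit
  rw [litv_even]
  unfold val
  rw [if_neg (by omega), if_pos (by omega), show (1296 + A * 6 + x - 1296) / 6 = A by omega,
    show (1296 + A * 6 + x - 1296) % 6 = x by omega]

theorem litv_f' (A x : ℕ) (hA : A < 64) (hx : x < 6) : litv m F W (fLit A x + 1) ↔ ¬ F A x := by
  rw [← litv_f (m := m) (F := F) (W := W) A x hA hx]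
  unfold fLit
  rw [litv_odd, litv_even]

theorem litv_w (A x e : ℕ) (hx : x < 6) (he : e < 6) :
    litv m F W (wLit A x e) ↔ W A x e := by
  unfold wLit
  rw [litv_even]
  unfold val
  rw [if_neg (by omega), if_neg (by omega),
    show (1680 + (A * 6 + x) * 6 + e - 1680) / 36 = A by omega,
    show (1680 + (A * 6 + x) * 6 + e - 1680) / 6 % 6 = x by omega,
    show (1680 + (A * 6 + x) * 6 + e - 1680) % 6 = e by omega]

theorem litv_w' (A x e : ℕ) (hx : x < 6) (he : e < 6) :
    litv m F W (wLit A x e + 1) ↔ ¬ W A x e := by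
  rw [← litv_w (m := m) (F := F) (W := W) A x e hx he]
  unfold wLit
  rw [litv_odd, litv_even]

theorem mn_cases (a b : ℕ) : mn a b = a ∨ mn a b = b := by
  unfold mn
  cases Nat.ble a b <;> simp

theorem okE_iff {e : ℕ} : okE N e = true ↔ e / 6 < N ∧ e % 6 < N ∧ e / 6 ≠ e % 6 := by
  simp only [okE, Bool.and_eq_true, Bool.not_eq_true', beqF, Nat.ble_eq, Nat.succ_le_iff, and_assoc,
    ne_eq]

theorem litv_g (M : Model N facts m F W) (e f : ℕ) (he : okE N e = true) (hf : okE N f = true)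
    (hef : e ≠ f) :
    litv m F W (gLit e f) ↔ m (f / 6) (f % 6) < m (e / 6) (e % 6) := by
  rw [okE_iff] at he hf
  have hN := M.hN
  have r1 : ∀ e, e / 6 < 6 → revE e / 6 = e % 6 := by intro e h; unfold revE; omega
  have r2 : ∀ e, e / 6 < 6 → revE e % 6 = e / 6 := by intro e h; unfold revE; omega
  have r3 : ∀ e, e / 6 < 6 → revE e < 36 := by intro e h; unfold revE; omega
  have a1 := M.anti (e / 6) (e % 6)
  have a2 := M.anti (f / 6) (f % 6)
  have hne : m (e / 6) (e % 6) ≠ m (f / 6) (f % 6) := by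
    intro h
    have := M.inj _ _ _ _ he.1 he.2.1 hf.1 hf.2.1 he.2.2 hf.2.2 h
    omega
  have re1 := r1 e (by omega)
  have re2 := r2 e (by omega)
  have re3 := r3 e (by omega)
  have rf1 := r1 f (by omega)
  have rf2 := r2 f (by omega)
  have rf3 := r3 f (by omega)
  unfold gLit
  cases Nat.ble (mn (e * 36 + f) (revE f * 36 + revE e)) (mn (f * 36 + e) (revE e * 36 + revE f))
  · simp only [cond_false]
    rw [litv_odd]
    rcases mn_cases (f * 36 + e) (revE e * 36 + revE f) with h | h <;> rw [h]
    · rw [val_gt _ _ (by omega) (by omega)]; omega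
    · rw [val_gt _ _ (by omega) (by omega), re1, re2, rf1, rf2]; omega
  · simp only [cond_true]
    rw [litv_even]
    rcases mn_cases (e * 36 + f) (revE f * 36 + revE e) with h | h <;> rw [h]
    · rw [val_gt _ _ (by omega) (by omega)]
    · rw [val_gt _ _ (by omega) (by omega), re1, re2, rf1, rf2]; omega

theorem cl_taut : Cl m F W taut := by
  by_cases h : val m F W 0
  · exact ⟨0, by simp [taut], (litv_even 0).2 h⟩
  · exact ⟨1, by simp [taut], (litv_odd 0).2 h⟩

theorem cl_cond (b : Bool) (C : List ℕ) (h : b = true → Cl m F W C) :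
    Cl m F W (bif b then C else taut) := by
  cases b
  · exact cl_taut
  · exact h rfl

theorem mem_bits {A x : ℕ} : x ∈ bits A ↔ x < 6 ∧ A.testBit x = true := by
  unfold bits
  rw [List.mem_filter]
  have : x ∈ [0, 1, 2, 3, 4, 5] ↔ x < 6 := by simp; omega
  rw [this]

theorem lt_of_testBit {A x : ℕ} (hA : A < 2 ^ N) (h : A.testBit x = true) : x < N := by
  by_contra hx
  have := Nat.testBit_lt_two_pow (x := A) (i := x)
    (lt_of_lt_of_le hA (Nat.pow_le_pow_right (by norm_num) (by omega)))
  simp [this] at h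

theorem okA_iff {A : ℕ} : okA N A = true ↔ 0 < A ∧ A < 2 ^ N := by
  simp [okA, Nat.succ_le_iff]

theorem mem_iff {A x : ℕ} : mem A x = true ↔ x < 6 ∧ A.testBit x = true := by
  simp [mem]

theorem okPath_iff (q : List ℕ) : okPath N q = true ↔
    q.Nodup ∧ ∀ x ∈ q, x < N ∧ x ≠ 0 ∧ x ≠ 4 := by
  induction q with
  | nil => simp [okPath]
  | cons x q ih =>
    simp only [okPath, Bool.and_eq_true, ih, List.nodup_cons, List.mem_cons, List.all_eq_true,
      Nat.ble_eq, Bool.not_eq_true', beqF, forall_eq_or_imp]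
    constructor
    · rintro ⟨⟨⟨⟨h1, h2⟩, h3⟩, h4⟩, h5, h6⟩
      exact ⟨⟨fun h => h4 x h rfl, h5⟩, ⟨h1, h2, h3⟩, h6⟩
    · rintro ⟨⟨h4, h5⟩, ⟨h1, h2, h3⟩, h6⟩
      exact ⟨⟨⟨⟨h1, h2⟩, h3⟩, fun y hy h => h4 (h ▸ hy)⟩, h5, h6⟩

theorem cl_path (M : Model N facts m F W) (q : List ℕ) : ∀ a, a < N → a ≠ 4 →
    (a :: q).Nodup → (∀ x ∈ q, x < N ∧ x ≠ 0 ∧ x ≠ 4) →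
    (∃ e ∈ (a :: q).zip (q ++ [4]), m e.1 e.2 ≤ m 4 0) → Cl m F W (pathLits a q) := by
  have hN := M.hN
  have hN' := M.hN'
  have key : ∀ a x, a < N → x < N → a ≠ x → x ≠ 0 → m a x ≤ m 4 0 →
      litv m F W (gLit 24 (6 * a + x)) := by
    intro a x ha hx hax hx0 h
    have e1 : (6 * a + x) / 6 = a := by omega
    have e2 : (6 * a + x) % 6 = x := by omega
    rw [litv_g M _ _ (by rw [okE_iff]; omega) (by rw [okE_iff, e1, e2]; omega) (by omega), e1, e2]
    refine lt_of_le_of_ne h fun h' => ?_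
    have := M.inj _ _ _ _ ha hx (by omega) (by omega) hax (by omega) h'
    omega
  induction q with
  | nil =>
    rintro a ha ha4 - - ⟨e, he, h⟩
    simp at he
    subst he
    exact ⟨_, by simp [pathLits], key a 4 ha (by omega) ha4 (by omega) h⟩
  | cons x q ih =>
    rintro a ha ha4 hnd hq ⟨e, he, h⟩
    have hx := hq x (by simp)
    simp only [List.cons_append, List.zip_cons_cons, List.mem_cons] at he
    rcases he with rfl | he
    · refine ⟨_, List.mem_cons_self, key a x ha hx.1 ?_ hx.2.1 h⟩
      rintro rfl
      simp at hnd
    · obtain ⟨l, hl, hv⟩ := ih x hx.1 hx.2.2 (List.nodup_cons.1 hnd).2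
        (fun y hy => hq y (by simp [hy])) ⟨e, he, h⟩
      exact ⟨l, by simp [pathLits, hl], hv⟩

theorem cl_ax (M : Model N facts m F W) (hfacts : ∀ p ∈ facts, p.2 < 6) (l : List ℕ) :
    Cl m F W (axClause N facts l) := by
  have hN := M.hN
  have hN' := M.hN'
  have h64 : 2 ^ N ≤ 64 := by
    calc 2 ^ N ≤ 2 ^ 6 := Nat.pow_le_pow_right (by norm_num) hN
      _ = 64 := by norm_num
  unfold axClause
  split
  · exact cl_taut
  · split
    · rename_i e f g
      refine cl_cond _ _ fun h => ?_
      simp only [Bool.and_eq_true, Bool.not_eq_true', beqF] at h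
      obtain ⟨⟨⟨⟨⟨h1, h2⟩, h3⟩, h4⟩, h5⟩, h6⟩ := h
      by_cases c1 : m (e / 6) (e % 6) < m (f / 6) (f % 6)
      · exact ⟨_, by simp, (litv_g M f e h2 h1 h4.symm).2 c1⟩
      by_cases c2 : m (f / 6) (f % 6) < m (g / 6) (g % 6)
      · exact ⟨gLit g f, by simp, (litv_g M g f h3 h2 h5.symm).2 c2⟩
      refine ⟨gLit e g, by simp, (litv_g M e g h1 h3 h6).2 ?_⟩
      rw [okE_iff] at h1 h2 h3
      rcases lt_or_eq_of_le (not_lt.1 c1) with c | c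
      · omega
      · have := M.inj _ _ _ _ h2.1 h2.2.1 h1.1 h1.2.1 h2.2.2 h1.2.2 c
        omega
    · exact cl_taut
  · split
    · rename_i A
      refine cl_cond _ _ fun h => ?_
      rw [okA_iff] at h
      obtain ⟨x, hx, hb, hF⟩ := M.alo A h.1 h.2
      exact ⟨fLit A x, List.mem_map.2 ⟨x, mem_bits.2 ⟨by omega, hb⟩, rfl⟩,
        (litv_f A x (by omega) (by omega)).2 hF⟩
    · exact cl_taut
  · split
    · rename_i A x y
      refine cl_cond _ _ fun h => ?_
      simp only [Bool.and_eq_true, Bool.not_eq_true', beqF, okA_iff,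
        mem_iff] at h
      obtain ⟨⟨⟨h1, h2⟩, h3⟩, h4⟩ := h
      by_cases c1 : F A x
      · by_cases c2 : F A y
        · exact absurd (M.amo A x y h1.2 (lt_of_testBit h1.2 h2.2) (lt_of_testBit h1.2 h3.2)
            h2.2 h3.2 c1 c2) h4
        · exact ⟨fLit A y + 1, by simp, (litv_f' A y (by omega) h3.1).2 c2⟩
      · exact ⟨fLit A x + 1, by simp, (litv_f' A x (by omega) h2.1).2 c1⟩
    · exact cl_taut
  · split
    · rename_i A x
      refine cl_cond _ _ fun h => ?_
      simp only [Bool.and_eq_true, Bool.not_eq_true', beqF, okA_iff,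
        mem_iff] at h
      obtain ⟨⟨h1, h2⟩, h4⟩ := h
      by_cases c1 : F A x
      · obtain ⟨e, he, hb, hne, hW⟩ := M.ex A x h1.2 (lt_of_testBit h1.2 h2.2) h2.2 h4 c1
        refine ⟨wLit A x e, ?_, (litv_w A x e h2.1 (by omega)).2 hW⟩
        refine List.mem_cons_of_mem _ (List.mem_map.2 ⟨e, List.mem_filter.2
          ⟨mem_bits.2 ⟨by omega, hb⟩, ?_⟩, rfl⟩)
        rw [beqF.2 hne]; rfl
      · exact ⟨fLit A x + 1, by simp, (litv_f' A x (by omega) h2.1).2 c1⟩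
    · exact cl_taut
  · split
    · rename_i A x e
      refine cl_cond _ _ fun h => ?_
      simp only [Bool.and_eq_true, Bool.not_eq_true', beqF, okA_iff,
        mem_iff] at h
      obtain ⟨⟨⟨h1, h2⟩, h3⟩, h4⟩ := h
      by_cases c1 : W A x e
      · exact ⟨fLit (del A e) x, by simp, (litv_f _ x (del_lt (by omega)) h2.1).2
          (M.wf A x e h1.2 (lt_of_testBit h1.2 h2.2) (lt_of_testBit h1.2 h3.2) h2.2 h3.2 h4 c1)⟩
      · exact ⟨wLit A x e + 1, by simp, (litv_w' A x e h2.1 h3.1).2 c1⟩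
    · exact cl_taut
  · split
    · rename_i A x e c d
      refine cl_cond _ _ fun h => ?_
      simp only [Bool.and_eq_true, Bool.not_eq_true', beqF, okA_iff,
        mem_iff, Bool.and_eq_false_iff] at h
      obtain ⟨⟨⟨⟨⟨⟨⟨h1, h2⟩, h3⟩, h4⟩, h5⟩, h6⟩, h7⟩, h8⟩ := h
      have bx := lt_of_testBit h1.2 h2.2
      have be := lt_of_testBit h1.2 h3.2
      have bc := lt_of_testBit h1.2 h4.2
      have bd := lt_of_testBit h1.2 h5.2
      by_cases c1 : W A x e
      · by_cases c2 : F (del A d) c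
        · refine ⟨gLit (6 * x + e) (6 * c + d), by simp, ?_⟩
          have e1 : (6 * x + e) / 6 = x := by omega
          have e2 : (6 * x + e) % 6 = e := by omega
          have e3 : (6 * c + d) / 6 = c := by omega
          have e4 : (6 * c + d) % 6 = d := by omega
          rw [litv_g M _ _ (by rw [okE_iff, e1, e2]; omega) (by rw [okE_iff, e3, e4]; omega)
            (by omega), e1, e2, e3, e4]
          exact M.wg A x e c d h1.2 bx be bc bd h2.2 h3.2 h4.2 h5.2 h6 h7 (by omega) c1 c2
        · exact ⟨fLit (del A d) c + 1, by simp, (litv_f' _ c (del_lt (by omega)) h4.1).2 c2⟩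
      · exact ⟨wLit A x e + 1, by simp, (litv_w' A x e h2.1 h3.1).2 c1⟩
    · exact cl_taut
  · refine ⟨gLit 24 4, by simp, ?_⟩
    rw [litv_g M _ _ (by rw [okE_iff]; omega) (by rw [okE_iff]; omega) (by omega)]
    exact M.top0
  · split
    · rename_i x d
      refine cl_cond _ _ fun h => ?_
      simp only [Bool.and_eq_true, Bool.not_eq_true', beqF, Nat.ble_eq] at h
      obtain ⟨⟨h1, h2⟩, h3⟩ := h
      have h1' := okE_iff.1 h1
      have e1 : (6 * x + d) / 6 = x := by omega
      have e2 : (6 * x + d) % 6 = d := by omega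
      rw [e1, e2] at h1'
      by_cases c : F (del (2 ^ N - 1) d) x
      · refine ⟨gLit 4 (6 * x + d), by simp, ?_⟩
        rw [litv_g M _ _ (by rw [okE_iff]; omega) h1 (by omega), e1, e2]
        exact M.top x d h1'.1 h1'.2.1 h1'.2.2 (by omega) c
      · exact ⟨fLit (del (2 ^ N - 1) d) x + 1, by simp,
          (litv_f' _ x (del_lt (by omega)) (by omega)).2 c⟩
    · exact cl_taut
  · split
    · rename_i d
      refine cl_cond _ _ fun h => ?_
      simp only [Bool.and_eq_true, Bool.not_eq_true', beqF, Nat.ble_eq] at h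
      exact ⟨_, List.mem_cons_self, (litv_f' _ 0 (del_lt (by omega)) (by omega)).2
        (M.notw d (by omega) h.1.2 h.2)⟩
    · exact cl_taut
  · rename_i q
    refine cl_cond _ _ fun h => ?_
    rw [okPath_iff] at h
    refine cl_path M q 0 (by omega) (by omega) ?_ h.2 (M.path q h.1 h.2)
    exact List.nodup_cons.2 ⟨fun h0 => (h.2 0 h0).2.1 rfl, h.1⟩
  · split
    · rename_i d x
      refine cl_cond _ _ fun h => ?_
      rw [List.any_eq_true] at h
      obtain ⟨p, hp, h⟩ := h
      simp only [Bool.and_eq_true, Nat.beq_eq] at h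
      obtain ⟨rfl, rfl⟩ := h
      exact ⟨_, List.mem_cons_self, (litv_f _ _ (del_lt (by omega)) (hfacts p hp)).2
        (M.fact p hp)⟩
    · exact cl_taut
  · exact cl_taut

/-- All clauses of a database hold. -/
def AllT (P : List ℕ → Prop) : Tr → Prop
  | .nil => True
  | .node c l r => P c ∧ AllT P l ∧ AllT P r

theorem AllT.get {P : List ℕ → Prop} (h0 : P taut) :
    ∀ (t : Tr) (n : ℕ), AllT P t → P (t.get n)
  | .nil, _, _ => h0
  | .node c l r, n, h => by
    unfold Tr.get
    cases Nat.beq n 0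
    · cases Nat.beq (n % 2) 1
      · exact AllT.get h0 r _ h.2.2
      · exact AllT.get h0 l _ h.2.1
    · exact h.1

theorem AllT.ins {P : List ℕ → Prop} {c : List ℕ} (hc : P c) :
    ∀ (t : Tr) (n : ℕ), AllT P t → AllT P (t.ins c n)
  | .nil, _, _ => ⟨hc, trivial, trivial⟩
  | .node c' l r, n, h => by
    unfold Tr.ins
    cases Nat.beq n 0
    · cases Nat.beq (n % 2) 1
      · exact ⟨h.1, h.2.1, AllT.ins hc r _ h.2.2⟩
      · exact ⟨h.1, AllT.ins hc l _ h.2.1, h.2.2⟩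
    · exact ⟨hc, h.2⟩

theorem cl_rem {M : ℕ} (hM : ∀ l, M.testBit l = true → ¬ litv m F W l) (C : List ℕ)
    (hC : Cl m F W C) : Cl m F W (remLits M C) := by
  induction C with
  | nil => exact hC
  | cons a C ih =>
    obtain ⟨l, hl, hv⟩ := hC
    unfold remLits
    cases hb : M.testBit a
    · rcases List.mem_cons.1 hl with rfl | hl
      · exact ⟨l, List.mem_cons_self, hv⟩
      · obtain ⟨l', h1, h2⟩ := ih ⟨l, hl, hv⟩
        exact ⟨l', List.mem_cons_of_mem _ h1, h2⟩
    · rcases List.mem_cons.1 hl with rfl | hl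
      · exact absurd hv (hM _ hb)
      · exact ih ⟨l, hl, hv⟩

theorem mark_inv {M a : ℕ} (hM : ∀ l, M.testBit l = true → ¬ litv m F W l)
    (ha : ¬ litv m F W a) : ∀ l, (M ||| 2 ^ a).testBit l = true → ¬ litv m F W l := by
  intro l hl
  rw [Nat.testBit_or, Bool.or_eq_true, Nat.testBit_two_pow] at hl
  rcases hl with hl | hl
  · exact hM l hl
  · have : a = l := by simpa using hl
    exact this ▸ ha

theorem mark_sound (C : List ℕ) : ∀ M : ℕ, (∀ l, M.testBit l = true → ¬ litv m F W l) →
    (∀ l ∈ C, ¬ litv m F W l) → ∀ l, (mark C M).testBit l = true → ¬ litv m F W l := by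
  induction C with
  | nil => intro M hM _; exact hM
  | cons a C ih =>
    intro M hM hC
    exact ih _ (mark_inv hM (hC a List.mem_cons_self))
      fun l hl => hC l (List.mem_cons_of_mem _ hl)

theorem prop_sound {t : Tr} (ht : AllT (Cl m F W) t) (hs : List ℕ) : ∀ M : ℕ,
    (∀ l, M.testBit l = true → ¬ litv m F W l) → prop t hs M = true → False := by
  induction hs with
  | nil => intro M _ h; simp [prop] at h
  | cons a hs ih =>
    intro M hM h
    have hc := cl_rem hM _ (AllT.get cl_taut t a ht)
    unfold prop at h
    split at h
    · rename_i h0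
      rw [h0] at hc
      obtain ⟨l, hl, _⟩ := hc
      simp at hl
    · rename_i l h0
      rw [h0] at hc
      obtain ⟨l', hl, hv⟩ := hc
      have : l' = l := by simpa using hl
      subst this
      exact ih _ (mark_inv hM (by rw [litv_opp, not_not]; exact hv)) h
    · simp at h

theorem run_sound (ss : List ℕ) : ∀ (t : Tr) (n : ℕ), AllT (Cl m F W) t →
    run ss t n = true → False := by
  induction ss with
  | nil => intro t n _ h; simp [run] at h
  | cons s ss ih =>
    intro t n ht h
    unfold run at h
    split at h
    · simp at h
    · rename_i k ds _
      cases hp : prop t (ds.drop k) (mark (ds.take k) 0)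
      · rw [hp] at h; simp at h
      · rw [hp, cond_true] at h
        have hcl : Cl m F W (ds.take k) := by
          by_contra hn
          refine prop_sound ht _ _ (mark_sound (ds.take k) 0 ?_ ?_) hp
          · intro l hl; simp at hl
          · intro l hl hv; exact hn ⟨l, hl, hv⟩
        split at h
        · obtain ⟨l, hl, _⟩ := hcl
          simp at hl
        · exact ih _ _ (AllT.ins hcl t n ht) h

theorem load_sound (M : Model N facts m F W) (hfacts : ∀ p ∈ facts, p.2 < 6) (as : List ℕ) :
    ∀ (t : Tr) (n : ℕ), AllT (Cl m F W) t → AllT (Cl m F W) (load N facts as t n).1 := by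
  induction as with
  | nil => intro t n h; exact h
  | cons a as ih => intro t n h; exact ih _ _ (AllT.ins (cl_ax M hfacts _) t n h)

theorem check_sound (M : Model N facts m F W) (hfacts : ∀ p ∈ facts, p.2 < 6)
    {axs steps : List ℕ} (h : check N facts axs steps = true) : False :=
  run_sound steps _ _ (load_sound M hfacts axs .nil 0 trivial) h

end sound

end SSVCheck

/-! ## Integer margins and basic facts about SSV winners -/

namespace SSVRed

open SSVCheck

section

variable {X : Type} [DecidableEq X] {V : Finset X} {succ : X × X → X × X → Prop}

open Classical in
theorem exists_margin (h : IsLinearOMM V succ) : ∃ M : X → X → ℤ,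
    (∀ a b, M b a = - M a b) ∧
    (∀ a b c d, a ∈ V → b ∈ V → c ∈ V → d ∈ V → (succ (a, b) (c, d) ↔ M c d < M a b)) := by
  obtain ⟨⟨_, hasym, hneg, hskew⟩, _⟩ := h
  let rk : X × X → ℕ := fun p => ((V ×ˢ V).filter fun q => succ p q).card
  have hrk : ∀ p q : X × X, p.1 ∈ V → p.2 ∈ V → q.1 ∈ V → q.2 ∈ V →
      (succ p q ↔ rk q < rk p) := by
    intro p q hp1 hp2 hq1 hq2
    constructor
    · intro hpq
      apply Finset.card_lt_card
      rw [Finset.ssubset_iff_of_subset]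
      · refine ⟨q, ?_, ?_⟩
        · simp [hq1, hq2, hpq]
        · intro hmem
          have hqq := (Finset.mem_filter.1 hmem).2
          exact hasym q q hq1 hq2 hq1 hq2 hqq hqq
      · intro r hr
        simp only [Finset.mem_filter, Finset.mem_product] at hr ⊢
        refine ⟨hr.1, ?_⟩
        by_contra hpr
        exact hneg p r q hp1 hp2 hr.1.1 hr.1.2 hq1 hq2 hpr
          (hasym q r hq1 hq2 hr.1.1 hr.1.2 hr.2) hpq
    · intro hlt
      by_contra hpq
      refine absurd hlt (not_lt.2 (Finset.card_le_card ?_))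
      intro r hr
      simp only [Finset.mem_filter, Finset.mem_product] at hr ⊢
      refine ⟨hr.1, ?_⟩
      by_contra hqr
      exact hneg p q r hp1 hp2 hq1 hq2 hr.1.1 hr.1.2 hpq hqr hr.2
  refine ⟨fun a b => (rk (a, b) : ℤ) - rk (b, a), fun a b => by ring, ?_⟩
  intro a b c d ha hb hc hd
  have h1 := hrk (a, b) (c, d) ha hb hc hd
  have h2 := hrk (d, c) (b, a) hd hc hb ha
  have h3 := hskew a b c d ha hb hc hd
  constructor
  · intro h
    have := h1.1 h
    have := h2.1 (h3.1 h)
    dsimp only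
    omega
  · intro h
    by_contra hn
    have e1 := mt h1.2 hn
    have e2 := mt h2.2 (mt h3.2 hn)
    dsimp only at h
    omega

theorem ssv_iff (hV : V.Nonempty) (a : X) : SSVwin V succ a ↔ V = {a} ∨
    (1 < V.card ∧ ∃ b ∈ V, a ∈ V.erase b ∧ SSVwin (V.erase b) succ a ∧
      ∀ c d : X, d ∈ V → c ∈ V.erase d → (c, d) ≠ (a, b) →
        SSVwin (V.erase d) succ c → succ (a, b) (c, d)) := by
  obtain ⟨n, hn⟩ : ∃ n, V.card = n + 1 := ⟨V.card - 1, by have := hV.card_pos; omega⟩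
  have hc : ∀ d ∈ V, (V.erase d).card = n := by
    intro d hd
    rw [Finset.card_erase_of_mem hd, hn]
    rfl
  unfold SSVwin
  rw [hn, SSVwinAux]
  refine or_congr Iff.rfl (and_congr (by rw [hn]) (exists_congr fun b => ?_))
  refine and_congr_right fun hb => and_congr_right fun _ => and_congr (by rw [hc b hb]) ?_
  refine forall_congr' fun c => forall_congr' fun d => forall_congr' fun hd => ?_
  rw [hc d hd]

theorem ssv_mem (hV : V.Nonempty) {a : X} (h : SSVwin V succ a) : a ∈ V := by
  rcases (ssv_iff hV a).1 h with h | ⟨_, b, _, h, _⟩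
  · rw [h]; simp
  · exact Finset.mem_of_mem_erase h

/-- Strict antisymmetric margins representing `succ`, injective on distinct pairs. -/
structure Marg (V : Finset X) (succ : X × X → X × X → Prop) (M : X → X → ℤ) : Prop where
  anti : ∀ a b, M b a = - M a b
  iff : ∀ a b c d, a ∈ V → b ∈ V → c ∈ V → d ∈ V → (succ (a, b) (c, d) ↔ M c d < M a b)
  inj : ∀ a b c d, a ∈ V → b ∈ V → c ∈ V → d ∈ V → a ≠ b → c ≠ d → M a b = M c d →
    a = c ∧ b = d

theorem exists_marg (h : IsLinearOMM V succ) : ∃ M, Marg V succ M := by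
  obtain ⟨M, h1, h2⟩ := exists_margin h
  refine ⟨M, h1, h2, ?_⟩
  intro a b c d ha hb hc hd hab hcd he
  by_contra hne
  have := h.2 a b c d ha hb hc hd hab hcd (fun h => hne (Prod.mk.injEq _ _ _ _ ▸ h))
  rw [h2 a b c d ha hb hc hd, h2 c d a b hc hd ha hb] at this
  omega

variable {M : X → X → ℤ}

theorem Marg.mono (h : Marg V succ M) {U : Finset X} (hU : U ⊆ V) : Marg U succ M :=
  ⟨h.anti, fun a b c d ha hb hc hd => h.iff a b c d (hU ha) (hU hb) (hU hc) (hU hd),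
    fun a b c d ha hb hc hd => h.inj a b c d (hU ha) (hU hb) (hU hc) (hU hd)⟩

theorem ssv_unique (h : Marg V succ M) (hV : V.Nonempty) {a a' : X} (h1 : SSVwin V succ a)
    (h2 : SSVwin V succ a') : a = a' := by
  rcases (ssv_iff hV a).1 h1 with e1 | ⟨c1, b, hb, hab, hw, hm⟩
  · have := ssv_mem hV h2
    rw [e1] at this
    exact (Finset.mem_singleton.1 this).symm
  · rcases (ssv_iff hV a').1 h2 with e2 | ⟨c2, b', hb', hab', hw', hm'⟩
    · rw [e2] at c1
      simp at c1
    · by_contra hne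
      have m1 := Finset.mem_of_mem_erase hab
      have m2 := Finset.mem_of_mem_erase hab'
      have s1 := hm a' b' hb' hab' (fun h => hne (congrArg Prod.fst h).symm) hw'
      have s2 := hm' a b hb hab (fun h => hne (congrArg Prod.fst h)) hw
      rw [h.iff a b a' b' m1 hb m2 hb'] at s1
      rw [h.iff a' b' a b m2 hb' m1 hb] at s2
      omega

open Classical in
theorem ssv_exists : ∀ (n : ℕ) (V : Finset X), V.card = n + 1 → Marg V succ M →
    ∃ a ∈ V, SSVwin V succ a := by
  intro n
  induction n with
  | zero =>
    intro V hc _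
    obtain ⟨a, rfl⟩ := Finset.card_eq_one.1 hc
    exact ⟨a, by simp, (ssv_iff (by simp) a).2 (Or.inl rfl)⟩
  | succ n ih =>
    intro V hc h
    have hV : V.Nonempty := Finset.card_pos.1 (by omega)
    have hE : ∀ d ∈ V, ∃ c ∈ V.erase d, SSVwin (V.erase d) succ c := fun d hd =>
      ih (V.erase d) (by rw [Finset.card_erase_of_mem hd]; omega) (h.mono (Finset.erase_subset _ _))
    let P := (V ×ˢ V).filter fun p => p.1 ≠ p.2 ∧ SSVwin (V.erase p.2) succ p.1
    have hP : P.Nonempty := by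
      obtain ⟨d, hd⟩ := hV
      obtain ⟨c, hc, hw⟩ := hE d hd
      refine ⟨(c, d), ?_⟩
      simp only [P, Finset.mem_filter, Finset.mem_product]
      exact ⟨⟨Finset.mem_of_mem_erase hc, hd⟩, Finset.ne_of_mem_erase hc, hw⟩
    obtain ⟨⟨a, b⟩, hab, hmax⟩ := Finset.exists_max_image P (fun p => M p.1 p.2) hP
    simp only [P, Finset.mem_filter, Finset.mem_product] at hab
    obtain ⟨⟨ha, hb⟩, hne, hw⟩ := hab
    refine ⟨a, ha, (ssv_iff hV a).2 (Or.inr ⟨by omega, b, hb, Finset.mem_erase.2 ⟨hne, ha⟩, hw, ?_⟩)⟩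
    intro c d hd hc hcd hw'
    have hcV := Finset.mem_of_mem_erase hc
    have hcne := Finset.ne_of_mem_erase hc
    have := hmax (c, d) (by
      simp only [P, Finset.mem_filter, Finset.mem_product]
      exact ⟨⟨hcV, hd⟩, hcne, hw'⟩)
    rw [h.iff a b c d ha hb hcV hd]
    refine lt_of_le_of_ne this fun he => hcd ?_
    obtain ⟨rfl, rfl⟩ := h.inj c d a b hcV hd ha hb hcne hne he
    rfl

theorem ssv_exists' (hV : V.Nonempty) (h : Marg V succ M) : ∃ a ∈ V, SSVwin V succ a :=
  ssv_exists (V.card - 1) V (by have := hV.card_pos; omega) h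

/-- If `b` defeats `w`, every path from `w` to `b` has an edge that is at most as strong. -/
theorem no_path (h : Marg V succ M) {b w : X} (hd : SCdefeats V succ b w) (q : List X)
    (hnd : (b :: w :: q).Nodup) (hq : ∀ x ∈ q, x ∈ V) :
    ∃ e ∈ (w :: q).zip (q ++ [b]), M e.1 e.2 ≤ M b w := by
  obtain ⟨hb, hw, hbw, hno⟩ := hd
  by_contra hcon
  push Not at hcon
  refine hno ⟨b :: w :: q, hnd, ?_, ?_⟩
  · intro x hx
    simp only [List.mem_cons] at hx
    rcases hx with rfl | rfl | hx
    · exact hb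
    · exact hw
    · exact hq x hx
  have hz : (b :: w :: q).zip ((b :: w :: q).rotate 1) = (b, w) :: (w :: q).zip (q ++ [b]) := by
    simp
  rw [hz]
  have hmem : ∀ e ∈ (w :: q).zip (q ++ [b]), e.1 ∈ V ∧ e.2 ∈ V := by
    rintro ⟨e1, e2⟩ he
    have h1 := (List.of_mem_zip he).1
    have h2 := (List.of_mem_zip he).2
    simp only [List.mem_cons, List.mem_append, List.not_mem_nil, or_false] at h1 h2
    constructor
    · rcases h1 with rfl | h1
      · exact hw
      · exact hq _ h1
    · rcases h2 with h2 | rfl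
      · exact hq _ h2
      · exact hb
  have hbw' := (h.iff b w w b hb hw hw hb).1 hbw
  have ha := h.anti b w
  refine ⟨?_, List.mem_cons_self, ?_⟩
  · intro e he
    rcases List.mem_cons.1 he with rfl | he
    · exact hbw
    · obtain ⟨h1, h2⟩ := hmem e he
      rw [h.iff _ _ _ _ h1 h2 h2 h1]
      have := hcon e he
      have := h.anti e.1 e.2
      omega
  · intro e he hs
    rcases List.mem_cons.1 he with rfl | he
    · rw [h.iff _ _ _ _ hb hw hb hw] at hs
      omega
    · obtain ⟨h1, h2⟩ := hmem e he
      rw [h.iff _ _ _ _ hb hw h1 h2] at hs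
      have := hcon e he
      omega

theorem testBit_del : ∀ A < 64, ∀ e < 6, A.testBit e = true → ∀ i < 6,
    (A - 2 ^ e).testBit i = (A.testBit i && !Nat.beq i e) := by
  decide +kernel

/-- The set of alternatives with code `A`. -/
def st (N : ℕ) (g : ℕ → X) (A : ℕ) : Finset X :=
  ((Finset.range N).filter fun i => A.testBit i = true).image g

theorem mem_st {N : ℕ} {g : ℕ → X} {A : ℕ} {x : X} :
    x ∈ st N g A ↔ ∃ i < N, A.testBit i = true ∧ g i = x := by
  simp [st, and_assoc]

/-- The hypothetical counterexample yields a model for the checker. -/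
theorem model (h : Marg V succ M) (N : ℕ) (hN : N ≤ 6) (hN' : 5 ≤ N) (g : ℕ → X)
    (ginj : ∀ i j, i < N → j < N → g i = g j → i = j)
    (hV : ∀ x, x ∈ V ↔ ∃ i < N, g i = x)
    (hdef : SCdefeats V succ (g 4) (g 0))
    (htop : ∀ x d, d ∈ V → x ∈ V.erase d → (x, d) ≠ (g 0, g 4) → SSVwin (V.erase d) succ x →
      succ (g 0, g 4) (x, d))
    (hnotw : ∀ d ∈ V, d ≠ g 0 → d ≠ g 4 → ¬ SSVwin (V.erase d) succ (g 0))
    (facts : List (ℕ × ℕ)) (hf : ∀ p ∈ facts, p.1 < N ∧ SSVwin (V.erase (g p.1)) succ (g p.2)) :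
    Model N facts (fun a b => M (g a) (g b)) (fun A x => SSVwin (st N g A) succ (g x))
      (fun A x e => SSVwin ((st N g A).erase (g e)) succ (g x) ∧
        ∀ c d, d ∈ st N g A → c ∈ (st N g A).erase d → (c, d) ≠ (g x, g e) →
          SSVwin ((st N g A).erase d) succ c → succ (g x, g e) (c, d)) := by
  have h64 : 2 ^ N ≤ 64 := by
    calc 2 ^ N ≤ 2 ^ 6 := Nat.pow_le_pow_right (by norm_num) hN
      _ = 64 := by norm_num
  have gV : ∀ i, i < N → g i ∈ V := fun i hi => (hV _).2 ⟨i, hi, rfl⟩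
  have gne : ∀ i j, i < N → j < N → i ≠ j → g i ≠ g j := fun i j hi hj hij he =>
    hij (ginj i j hi hj he)
  have hsub : ∀ A, st N g A ⊆ V := by
    intro A x hx
    obtain ⟨i, hi, _, rfl⟩ := mem_st.1 hx
    exact gV i hi
  have hmem : ∀ A i, i < N → A.testBit i = true → g i ∈ st N g A := fun A i hi hb =>
    mem_st.2 ⟨i, hi, hb, rfl⟩
  have hdel : ∀ A e, A < 2 ^ N → e < N → A.testBit e = true →
      st N g (A - 2 ^ e) = (st N g A).erase (g e) := by
    intro A e hA he hb
    ext x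
    rw [Finset.mem_erase, mem_st, mem_st]
    constructor
    · rintro ⟨i, hi, hbi, rfl⟩
      rw [testBit_del A (by omega) e (by omega) hb i (by omega), Bool.and_eq_true,
        Bool.not_eq_true', beqF] at hbi
      exact ⟨gne i e hi he hbi.2, i, hi, hbi.1, rfl⟩
    · rintro ⟨hne, i, hi, hbi, rfl⟩
      refine ⟨i, hi, ?_, rfl⟩
      rw [testBit_del A (by omega) e (by omega) hb i (by omega), Bool.and_eq_true,
        Bool.not_eq_true', beqF]
      exact ⟨hbi, fun hie => hne (by rw [hie])⟩
  have hfull : ∀ d, d < N → st N g (2 ^ N - 1 - 2 ^ d) = V.erase (g d) := by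
    intro d hd
    have hpos : 0 < 2 ^ N := by positivity
    rw [hdel _ _ (by omega) hd (by rw [Nat.testBit_two_pow_sub_one]; simpa using hd)]
    congr 1
    ext x
    rw [mem_st, hV]
    constructor
    · rintro ⟨i, hi, _, rfl⟩; exact ⟨i, hi, rfl⟩
    · rintro ⟨i, hi, rfl⟩
      exact ⟨i, hi, by rw [Nat.testBit_two_pow_sub_one]; simpa using hi, rfl⟩
  refine ⟨hN, hN', fun a b => h.anti _ _, ?_, ?_, ?_, ?_, ?_, ?_, ?_, ?_, ?_, ?_, ?_⟩
  · intro a b c d ha hb hc hd hab hcd he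
    obtain ⟨h1, h2⟩ := h.inj _ _ _ _ (gV a ha) (gV b hb) (gV c hc) (gV d hd) (gne a b ha hb hab)
      (gne c d hc hd hcd) he
    exact ⟨ginj _ _ ha hc h1, ginj _ _ hb hd h2⟩
  · intro A hA hA'
    obtain ⟨i, hi⟩ := Nat.exists_testBit_of_ne_zero hA.ne'
    obtain ⟨a, ha, hw⟩ := ssv_exists' ⟨g i, hmem A i (lt_of_testBit hA' hi) hi⟩ (h.mono (hsub A))
    obtain ⟨x, hx, hb, rfl⟩ := mem_st.1 ha
    exact ⟨x, hx, hb, hw⟩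
  · intro A x y hA hx hy hbx hby h1 h2
    exact ginj x y hx hy (ssv_unique (h.mono (hsub A)) ⟨_, hmem A x hx hbx⟩ h1 h2)
  · intro A x hA hx hb hne hw
    rcases (ssv_iff ⟨_, hmem A x hx hb⟩ _).1 hw with h1 | ⟨_, e, he, hxe, hw, hm⟩
    · exfalso
      apply hne
      apply Nat.eq_of_testBit_eq
      intro i
      rw [Nat.testBit_two_pow]
      by_cases hi : x = i
      · subst hi; simpa using hb
      · simp only [hi, decide_false]
        by_contra hbi
        rw [Bool.not_eq_false] at hbi
        have hiN := lt_of_testBit hA hbi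
        have := hmem A i hiN hbi
        rw [h1, Finset.mem_singleton] at this
        exact hi (ginj i x hiN hx this).symm
    · obtain ⟨i, hi, hbi, rfl⟩ := mem_st.1 he
      refine ⟨i, hi, hbi, ?_, hw, hm⟩
      rintro rfl
      simp at hxe
  · intro A x e hA hx he hbx hbe hne hW
    rw [hdel A e hA he hbe]
    exact hW.1
  · intro A x e c d hA hx he hc hd bx be bc bd hex hcd hne hW hF
    rw [hdel A d hA hd bd] at hF
    have := hW.2 (g c) (g d) (hmem A d hd bd)
      (Finset.mem_erase.2 ⟨gne c d hc hd hcd, hmem A c hc bc⟩)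
      (fun hp => hne ⟨ginj _ _ hc hx (congrArg Prod.fst hp), ginj _ _ hd he (congrArg Prod.snd hp)⟩)
      hF
    exact (h.iff _ _ _ _ (gV x hx) (gV e he) (gV c hc) (gV d hd)).1 this
  · exact (h.iff _ _ _ _ hdef.1 hdef.2.1 hdef.2.1 hdef.1).1 hdef.2.2.1
  · intro x d hx hd hxd hne hF
    rw [hfull d hd] at hF
    have := htop (g x) (g d) (gV d hd) (Finset.mem_erase.2 ⟨gne x d hx hd hxd, gV x hx⟩)
      (fun hp => hne ⟨ginj _ _ hx (by omega) (congrArg Prod.fst hp),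
        ginj _ _ hd (by omega) (congrArg Prod.snd hp)⟩) hF
    exact (h.iff _ _ _ _ hdef.2.1 hdef.1 (gV x hx) (gV d hd)).1 this
  · intro d hd h0 h4
    rw [hfull d hd]
    exact hnotw _ (gV d hd) (gne d 0 hd (by omega) h0) (gne d 4 hd (by omega) h4)
  · intro q hnd hq
    have hnd' : (g 4 :: g 0 :: q.map g).Nodup := by
      have : (4 :: 0 :: q).Nodup := by
        simp only [List.nodup_cons, List.mem_cons, not_or]
        exact ⟨⟨by omega, fun h => (hq 4 h).2.2 rfl⟩, fun h => (hq 0 h).2.1 rfl, hnd⟩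
      have hlt : ∀ x ∈ 4 :: 0 :: q, x < N := by
        intro x hx
        simp only [List.mem_cons] at hx
        rcases hx with rfl | rfl | hx
        · omega
        · omega
        · exact (hq x hx).1
      exact this.map_on (f := g) fun x hx y hy hxy => ginj x y (hlt x hx) (hlt y hy) hxy
    have hq' : ∀ x ∈ q.map g, x ∈ V := by
      intro x hx
      obtain ⟨i, hi, rfl⟩ := List.mem_map.1 hx
      exact gV i (hq i hi).1
    obtain ⟨e, he, hle⟩ := no_path h hdef (q.map g) hnd' hq'
    have hz : (g 0 :: q.map g).zip (q.map g ++ [g 4]) =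
        ((0 :: q).zip (q ++ [4])).map (Prod.map g g) := by
      rw [← List.zip_map]
      simp
    rw [hz, List.mem_map] at he
    obtain ⟨e', he', rfl⟩ := he
    exact ⟨e', he', hle⟩
  · intro p hp
    obtain ⟨h1, h2⟩ := hf p hp
    rw [hfull _ h1]
    exact h2

end

end SSVRed

/-! ## The main induction -/

namespace SSVRed

open SSVCheck

section

variable {X : Type} [DecidableEq X] {V : Finset X} {succ : X × X → X × X → Prop}

theorem linear_mono (h : IsLinearOMM V succ) {U : Finset X} (hU : U ⊆ V) (hne : U.Nonempty) :
    IsLinearOMM U succ := by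
  obtain ⟨⟨_, h1, h2, h3⟩, h4⟩ := h
  refine ⟨⟨hne, ?_, ?_, ?_⟩, ?_⟩
  · exact fun p q a b c d => h1 p q (hU a) (hU b) (hU c) (hU d)
  · exact fun p q r a b c d e f => h2 p q r (hU a) (hU b) (hU c) (hU d) (hU e) (hU f)
  · exact fun a b c d ha hb hc hd => h3 a b c d (hU ha) (hU hb) (hU hc) (hU hd)
  · exact fun a b c d ha hb hc hd => h4 a b c d (hU ha) (hU hb) (hU hc) (hU hd)

theorem defeats_mono {U : Finset X} (hU : U ⊆ V) {b w : X} (hb : b ∈ U) (hw : w ∈ U)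
    (h : SCdefeats V succ b w) : SCdefeats U succ b w := by
  obtain ⟨_, _, h1, h2⟩ := h
  refine ⟨hb, hw, h1, ?_⟩
  rintro ⟨l, hl, hm, hrest⟩
  exact h2 ⟨l, hl, fun x hx => hU (hm x hx), hrest⟩

variable {M : X → X → ℤ}

/-- Labels `0, …, 5` for six alternatives. -/
def lab (w p q r b s : X) : ℕ → X
  | 0 => w
  | 1 => p
  | 2 => q
  | 3 => r
  | 4 => b
  | _ => s

theorem core (h : Marg V succ M) (hcard : V.card ≤ 6) {w b : X} (hne : w ≠ b)
    (hdef : SCdefeats V succ b w) (hwin : SSVwin (V.erase b) succ w)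
    (htop : ∀ x d, d ∈ V → x ∈ V.erase d → (x, d) ≠ (w, b) → SSVwin (V.erase d) succ x →
      succ (w, b) (x, d))
    (hnotw : ∀ d ∈ V, d ≠ w → d ≠ b → ¬ SSVwin (V.erase d) succ w) : False := by
  have hb : b ∈ V := hdef.1
  have hw : w ∈ V := hdef.2.1
  have hpos : M w b < M b w := (h.iff b w w b hb hw hw hb).1 hdef.2.2.1
  have hwb := h.anti b w
  have step : ∀ d ∈ V, d ≠ b → ∃ y ∈ V, y ≠ d ∧ (d ≠ w → y ≠ w) ∧ SSVwin (V.erase d) succ y ∧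
      M b w < M d y := by
    intro d hd hdb
    obtain ⟨y, hy, hyw⟩ := ssv_exists' (V := V.erase d) ⟨b, Finset.mem_erase.2 ⟨hdb.symm, hb⟩⟩
      (h.mono (Finset.erase_subset _ _))
    have hyV := Finset.mem_of_mem_erase hy
    refine ⟨y, hyV, Finset.ne_of_mem_erase hy, ?_, hyw, ?_⟩
    · rintro hdw rfl
      exact hnotw d hd hdw hdb hyw
    · have := htop y d hd hy (fun hp => hdb (congrArg Prod.snd hp)) hyw
      rw [h.iff _ _ _ _ hw hb hyV hd] at this
      have := h.anti d y
      omega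
  obtain ⟨p, hp, hpw, -, Fp, mp⟩ := step w hw hne
  have hpb : p ≠ b := by
    rintro rfl
    omega
  obtain ⟨q, hq, hqp, hqw, Fq, mq⟩ := step p hp hpb
  have hqw := hqw hpw
  have hqb : q ≠ b := by
    rintro rfl
    obtain ⟨e, he, hle⟩ := no_path h hdef [p]
      (by simp; grind) (by simp [hp])
    simp at he
    rcases he with rfl | rfl <;> simp at hle <;> omega
  obtain ⟨r, hr, hrq, hrw, Fr, mr⟩ := step q hq hqb
  have hrw := hrw hqw
  have hrp : r ≠ p := by
    rintro rfl
    have := h.anti r q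
    omega
  have hrb : r ≠ b := by
    rintro rfl
    obtain ⟨e, he, hle⟩ := no_path h hdef [p, q]
      (by simp; grind) (by simp [hp, hq])
    simp at he
    rcases he with rfl | rfl | rfl <;> simp at hle <;> omega
  obtain ⟨t, ht, htr, htw, Ft, mt⟩ := step r hr hrb
  have htw := htw hrw
  have htq : t ≠ q := by
    rintro rfl
    have := h.anti t r
    omega
  have htb : t ≠ b := by
    rintro rfl
    obtain ⟨e, he, hle⟩ := no_path h hdef [p, q, r]
      (by simp; grind) (by simp [hp, hq, hr])
    simp at he
    rcases he with rfl | rfl | rfl | rfl <;> simp at hle <;> omega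
  -- all six-element cases share the same labelling facts
  have six : ∀ s ∈ V, s ≠ w → s ≠ p → s ≠ q → s ≠ r → s ≠ b →
      (∀ i j, i < 6 → j < 6 → lab w p q r b s i = lab w p q r b s j → i = j) ∧
      (∀ x, x ∈ V ↔ ∃ i < 6, lab w p q r b s i = x) := by
    intro s hs h1 h2 h3 h4 h5
    constructor
    · intro i j hi hj hij
      interval_cases i <;> interval_cases j <;> simp only [lab] at hij <;> first | rfl | grind
    · have hsub : ({w, p, q, r, b, s} : Finset X) ⊆ V := by
        intro x hx
        simp only [Finset.mem_insert, Finset.mem_singleton] at hx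
        rcases hx with rfl | rfl | rfl | rfl | rfl | rfl <;> assumption
      have hc : ({w, p, q, r, b, s} : Finset X).card = 6 := by
        rw [Finset.card_insert_of_notMem, Finset.card_insert_of_notMem,
          Finset.card_insert_of_notMem, Finset.card_insert_of_notMem,
          Finset.card_insert_of_notMem, Finset.card_singleton] <;> simp <;> grind
      have heq := Finset.eq_of_subset_of_card_le hsub (by omega)
      intro x
      rw [← heq]
      constructor
      · intro hx
        simp only [Finset.mem_insert, Finset.mem_singleton] at hx
        rcases hx with rfl | rfl | rfl | rfl | rfl | rfl
        exacts [⟨0, by omega, rfl⟩, ⟨1, by omega, rfl⟩, ⟨2, by omega, rfl⟩, ⟨3, by omega, rfl⟩,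
          ⟨4, by omega, rfl⟩, ⟨5, by omega, rfl⟩]
      · rintro ⟨i, hi, rfl⟩
        interval_cases i <;> simp [lab]
  by_cases htp : t = p
  · subst htp
    by_cases hs : ∃ s ∈ V, s ≠ w ∧ s ≠ t ∧ s ≠ q ∧ s ≠ r ∧ s ≠ b
    · obtain ⟨s, hs, h1, h2, h3, h4, h5⟩ := hs
      obtain ⟨e1, e2⟩ := six s hs h1 h2 h3 h4 h5
      refine check_sound (model h 6 le_rfl (by omega) (lab w t q r b s) e1 e2 hdef htop hnotw
        [(4, 0), (0, 1), (1, 2), (2, 3), (3, 1)] ?_) ?_ checkOne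
      · simp [lab, hwin, Fp, Fq, Fr, Ft]
      · simp
    · refine check_sound (model h 5 (by omega) le_rfl (lab w t q r b w) ?_ ?_ hdef htop hnotw
        [(4, 0), (0, 1), (1, 2), (2, 3), (3, 1)] ?_) ?_ checkFive
      · intro i j hi hj hij
        interval_cases i <;> interval_cases j <;> simp only [lab] at hij <;> first | rfl | grind
      · intro x
        constructor
        · intro hx
          by_contra hcon
          refine hs ⟨x, hx, ?_, ?_, ?_, ?_, ?_⟩ <;> intro he <;> apply hcon
          exacts [⟨0, by omega, he.symm⟩, ⟨1, by omega, he.symm⟩, ⟨2, by omega, he.symm⟩,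
            ⟨3, by omega, he.symm⟩, ⟨4, by omega, he.symm⟩]
        · rintro ⟨i, hi, rfl⟩
          interval_cases i <;> simp only [lab] <;> assumption
      · simp [lab, hwin, Fp, Fq, Fr, Ft]
      · simp
  · obtain ⟨e1, e2⟩ := six t ht htw htp htq htr htb
    obtain ⟨u, hu, hut, huw, Fu, mu⟩ := step t ht htb
    have huw := huw htw
    have hur : u ≠ r := by
      rintro rfl
      have := h.anti u t
      omega
    have hub : u ≠ b := by
      rintro rfl
      obtain ⟨e, he, hle⟩ := no_path h hdef [p, q, r, t]
        (by simp; grind) (by simp [hp, hq, hr, ht])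
      simp at he
      rcases he with rfl | rfl | rfl | rfl | rfl <;> simp at hle <;> omega
    have hu' : u = p ∨ u = q := by
      obtain ⟨i, hi, hiu⟩ := (e2 u).1 hu
      interval_cases i <;> simp only [lab] at hiu <;> grind
    rcases hu' with rfl | rfl
    · refine check_sound (model h 6 le_rfl (by omega) (lab w u q r b t) e1 e2 hdef htop hnotw
        [(4, 0), (0, 1), (1, 2), (2, 3), (3, 5), (5, 1)] ?_) ?_ checkTwo
      · simp [lab, hwin, Fp, Fq, Fr, Ft, Fu]
      · simp
    · refine check_sound (model h 6 le_rfl (by omega) (lab w p u r b t) e1 e2 hdef htop hnotw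
        [(4, 0), (0, 1), (1, 2), (2, 3), (3, 5), (5, 2)] ?_) ?_ checkThree
      · simp [lab, hwin, Fp, Fq, Fr, Ft, Fu]
      · simp

theorem main : ∀ (n : ℕ) (V : Finset X), V.card = n → n ≤ 6 → IsLinearOMM V succ →
    ∀ a, SSVwin V succ a → SCwinner V succ a := by
  intro n
  induction n with
  | zero =>
    intro V hc _ h
    exact absurd h.1.1.card_pos (by omega)
  | succ n ih =>
    intro V hc hn h w hw
    obtain ⟨M, hM⟩ := exists_marg h
    refine ⟨ssv_mem h.1.1 hw, ?_⟩
    intro x hx hdef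
    have hIH : ∀ d ∈ V, d ≠ w → d ≠ x → ¬ SSVwin (V.erase d) succ w := by
      intro d hd hdw hdx hwin
      have hwE : w ∈ V.erase d := Finset.mem_erase.2 ⟨hdw.symm, hdef.2.1⟩
      have hxE : x ∈ V.erase d := Finset.mem_erase.2 ⟨hdx.symm, hx⟩
      have hs := Finset.erase_subset d V
      refine (ih (V.erase d) (by rw [Finset.card_erase_of_mem hd]; omega) (by omega)
        (linear_mono h hs ⟨w, hwE⟩) w hwin).2 x hxE (defeats_mono hs hxE hwE hdef)
    rcases (ssv_iff h.1.1 w).1 hw with h1 | ⟨_, b, hb, hwb, hwin, htop⟩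
    · rw [h1, Finset.mem_singleton] at hx
      subst hx
      have := hdef.2.2.1
      rw [hM.iff _ _ _ _ hdef.1 hdef.1 hdef.1 hdef.1] at this
      omega
    · have hne := Finset.ne_of_mem_erase hwb
      by_cases hbx : b = x
      · subst hbx
        exact core hM (by omega) hne hdef hwin htop hIH
      · exact hIH b hb hne.symm hbx hwin

end

end SSVRed

/-- For any linear ordinal margin matrix with at most 6 alternatives, the SSV
winner is a Split Cycle winner. -/
theorem ssv_refines_sc_up_to_six {X : Type} [DecidableEq X] (V : Finset X)
    (succ : X × X → X × X → Prop) (h : IsLinearOMM V succ) (hcard : V.card ≤ 6) :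
    ∀ a, SSVwin V succ a → SCwinner V succ a :=
  SSVRed.main V.card V rfl hcard h
end

section
/- For every integer n ≥ 7, there exists a linear ordinal margin matrix with exactly n alternatives in which the SSV winner is not a Split Cycle winner. -/
variable {X : Type} [DecidableEq X]

/-- Margins of the seven-alternative example. -/
def cexTable : List (List ℤ) :=
  [[0, -12, 13, 14, -21, 18, 3],
   [12, 0, -10, -8, 20, -15, 1],
   [-13, 10, 0, 16, 5, -2, -7],
   [-14, 8, -16, 0, 17, -19, -11],
   [21, -20, -5, -17, 0, -9, 4],
   [-18, 15, 2, 19, 9, 0, 6],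
   [-3, -1, 7, 11, -4, -6, 0]]

/-- SSV winners of all subsets of the example, indexed by bitmask. -/
def cexWinners : List (Fin 7) :=
  [0, 0, 1, 1, 2, 0, 2, 1, 3, 0, 3, 1, 2, 0, 2, 1, 4, 4, 1, 1, 2, 4, 2, 1, 3, 3, 3, 1, 2, 2, 2, 1, 5, 0, 5, 0, 5, 0, 5, 0, 5, 0, 5, 0, 5, 0, 5, 0, 5, 4, 5, 1, 5, 4, 5, 1, 5, 4, 5, 1, 5, 2, 5, 2, 6, 0, 1, 1, 6, 0, 6, 1, 6, 0, 6, 1, 6, 0, 6, 1, 4, 4, 1, 1, 6, 4, 6, 1, 6, 6, 6, 1, 6, 6, 6, 1, 5, 0, 5, 0, 5, 0, 5, 0, 5, 0, 5, 0, 5, 0, 5, 0, 5, 4, 5, 1, 5, 4, 5, 1, 5, 4, 5, 1, 5, 4, 5, 2]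

/-- Table entry. -/
def cexT (a b : ℕ) : ℤ := (cexTable.getD a []).getD b 0

/-- The margin function on all naturals: later alternatives lose heavily to all earlier ones. -/
def cexM (a b : ℕ) : ℤ :=
  if a < 7 ∧ b < 7 then cexT a b
  else if a = b then 0
  else if a < b then 100 + (b : ℤ) * b + a
  else -(100 + (a : ℤ) * a + b)

/-- SSV winner of a subset of the example. -/
def cexW (V : Finset (Fin 7)) : Fin 7 := cexWinners.getD (∑ i ∈ V, 2 ^ (i : ℕ)) 0

/-- The strict weak order. -/
def cexSucc (n : ℕ) (p q : Fin n × Fin n) : Prop := cexM q.1 q.2 < cexM p.1 p.2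

theorem cexW_step : ∀ V : Finset (Fin 7), 1 < V.card →
    ∃ b ∈ V, cexW V ≠ b ∧ cexW V ∈ V ∧ cexW (V.erase b) = cexW V ∧
      ∀ d ∈ V, d ≠ b → cexT (cexW (V.erase d)) d < cexT (cexW V) b := by
  decide +kernel

theorem cexW_single : ∀ a : Fin 7, cexW {a} = a := by decide +kernel

theorem cexT_skew : ∀ a : Fin 7, ∀ b : Fin 7, cexT a b = - cexT b a := by decide +kernel

theorem cexT_bound : ∀ a : Fin 7, ∀ b : Fin 7, cexT a b ≤ 21 ∧ -21 ≤ cexT a b := by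
  decide +kernel

theorem cexT_inj : ∀ a b c d : Fin 7, a ≠ b → c ≠ d → cexT a b = cexT c d →
    a = c ∧ b = d := by decide +kernel

theorem cexT_six : ∀ a : Fin 7, cexT a 6 < 7 := by decide +kernel

theorem cexM_lt {a b : ℕ} (ha : a < 7) (hb : b < 7) : cexM a b = cexT a b := by
  simp [cexM, ha, hb]

theorem cexM_up {a b : ℕ} (hab : a < b) (hb : 7 ≤ b) : cexM a b = 100 + (b : ℤ) * b + a := by
  unfold cexM
  rw [if_neg (by omega), if_neg (by omega), if_pos hab]

theorem cexM_down {a b : ℕ} (hab : b < a) (ha : 7 ≤ a) :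
    cexM a b = -(100 + (a : ℤ) * a + b) := by
  unfold cexM
  rw [if_neg (by omega), if_neg (by omega), if_neg (by omega)]

theorem cexM_diag (a : ℕ) (ha : 7 ≤ a) : cexM a a = 0 := by
  unfold cexM
  rw [if_neg (by omega), if_pos rfl]

theorem cexM_cases (a b : ℕ) : (a < 7 ∧ b < 7 ∧ cexM a b ≤ 21 ∧ -21 ≤ cexM a b) ∨
    (a < b ∧ 7 ≤ b ∧ cexM a b = 100 + (b : ℤ) * b + a) ∨
    (b < a ∧ 7 ≤ a ∧ cexM a b = -(100 + (a : ℤ) * a + b)) ∨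
    (a = b ∧ cexM a b = 0) := by
  by_cases h : a < 7 ∧ b < 7
  · left
    rw [cexM_lt h.1 h.2]
    exact ⟨h.1, h.2, cexT_bound ⟨a, h.1⟩ ⟨b, h.2⟩⟩
  · right
    rcases lt_trichotomy a b with h1 | h1 | h1
    · exact Or.inl ⟨h1, by omega, cexM_up h1 (by omega)⟩
    · subst h1
      exact Or.inr (Or.inr ⟨rfl, cexM_diag a (by omega)⟩)
    · exact Or.inr (Or.inl ⟨h1, by omega, cexM_down h1 (by omega)⟩)

theorem cexM_skew (a b : ℕ) : cexM a b = - cexM b a := by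
  by_cases h : a < 7 ∧ b < 7
  · rw [cexM_lt h.1 h.2, cexM_lt h.2 h.1]
    exact cexT_skew ⟨a, h.1⟩ ⟨b, h.2⟩
  · rcases lt_trichotomy a b with h1 | h1 | h1
    · rw [cexM_up h1 (by omega), cexM_down h1 (by omega)]; ring
    · subst h1
      rw [cexM_diag a (by omega)]; rfl
    · rw [cexM_up h1 (by omega), cexM_down h1 (by omega)]

theorem cex_sq_inj {a b c d : ℕ} (hab : a < b) (hcd : c < d)
    (h : (100 : ℤ) + (b : ℤ) * b + a = 100 + (d : ℤ) * d + c) : a = c ∧ b = d := by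
  have h' : b * b + a = d * d + c := by
    have : (b : ℤ) * b + a = (d : ℤ) * d + c := by linarith
    exact_mod_cast this
  rcases lt_trichotomy b d with h1 | h1 | h1
  · nlinarith
  · subst h1
    exact ⟨by omega, rfl⟩
  · nlinarith

theorem cexM_inj {a b c d : ℕ} (hab : a ≠ b) (hcd : c ≠ d) (h : cexM a b = cexM c d) :
    a = c ∧ b = d := by
  have hp : ∀ x y : ℕ, (0 : ℤ) ≤ (x : ℤ) * x + y := fun x y => by positivity
  rcases cexM_cases a b with ⟨h1, h2, h3, h4⟩ | ⟨h1, h2, h3⟩ | ⟨h1, h2, h3⟩ | ⟨h1, h2⟩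
  · rcases cexM_cases c d with ⟨k1, k2, k3, k4⟩ | ⟨k1, k2, k3⟩ | ⟨k1, k2, k3⟩ | ⟨k1, k2⟩
    · rw [cexM_lt h1 h2, cexM_lt k1 k2] at h
      have := cexT_inj ⟨a, h1⟩ ⟨b, h2⟩ ⟨c, k1⟩ ⟨d, k2⟩ (by simpa using hab) (by simpa using hcd) h
      simpa using this
    · linarith [hp d c]
    · linarith [hp c d]
    · exact absurd k1 hcd
  · rcases cexM_cases c d with ⟨k1, k2, k3, k4⟩ | ⟨k1, k2, k3⟩ | ⟨k1, k2, k3⟩ | ⟨k1, k2⟩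
    · linarith [hp b a]
    · exact cex_sq_inj h1 k1 (by linarith)
    · linarith [hp c d, hp b a]
    · exact absurd k1 hcd
  · rcases cexM_cases c d with ⟨k1, k2, k3, k4⟩ | ⟨k1, k2, k3⟩ | ⟨k1, k2, k3⟩ | ⟨k1, k2⟩
    · linarith [hp a b]
    · linarith [hp d c, hp a b]
    · exact (cex_sq_inj h1 k1 (by linarith)).symm
    · exact absurd k1 hcd
  · exact absurd h1 hab

/-- Column `z ≥ 7` dominates all columns below. -/
theorem cexM_dom {x y w z : ℕ} (hz : 7 ≤ z) (hx : x < z) (hy : y ≤ z) (hw : w < z) :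
    cexM y w < cexM x z := by
  rw [cexM_up hx hz]
  have hp : ∀ x y : ℕ, (0 : ℤ) ≤ (x : ℤ) * x + y := fun x y => by positivity
  rcases cexM_cases y w with ⟨k1, k2, k3, k4⟩ | ⟨k1, k2, k3⟩ | ⟨k1, k2, k3⟩ | ⟨k1, k2⟩
  · linarith [hp z x]
  · rw [k3]
    have : w * w + y < z * z + x := by nlinarith
    have : (w : ℤ) * w + y < (z : ℤ) * z + x := by exact_mod_cast this
    linarith
  · linarith [hp z x, hp y w]
  · linarith [hp z x]

theorem ssvAux_unique {n : ℕ} (k : ℕ) (V : Finset (Fin n)) (a a' : Fin n)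
    (h : SSVwinAux (cexSucc n) k V a) (h' : SSVwinAux (cexSucc n) k V a') : a = a' := by
  cases k with
  | zero => exact absurd h (by simp [SSVwinAux])
  | succ k =>
    simp only [SSVwinAux] at h h'
    rcases h with h | ⟨hc, b, hb, hab, hs, hm⟩
    · rcases h' with h' | ⟨hc', _⟩
      · rw [h] at h'; simpa using h'
      · rw [h] at hc'; simp at hc'
    · rcases h' with h' | ⟨hc', b', hb', hab', hs', hm'⟩
      · rw [h'] at hc; simp at hc
      · by_contra hne
        have h1 := hm a' b' hb' hab' (by simp [Ne.symm hne]) hs'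
        have h2 := hm' a b hb hab (by simp [hne]) hs
        unfold cexSucc at h1 h2
        exact lt_asymm h1 h2

theorem ssv_base (n : ℕ) (hn : 7 ≤ n) : ∀ (k : ℕ) (V : Finset (Fin 7)), V.card = k + 1 →
    SSVwinAux (cexSucc n) (k + 1) (V.map (Fin.castLEEmb hn)) (Fin.castLE hn (cexW V)) := by
  intro k
  induction k with
  | zero =>
    intro V hV
    obtain ⟨a, rfl⟩ := Finset.card_eq_one.mp hV
    left
    simp [cexW_single]
  | succ k ih =>
    intro V hV
    obtain ⟨b, hb, hne, hmem, hw, hmax⟩ := cexW_step V (by omega)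
    have her : ∀ d, (V.map (Fin.castLEEmb hn)).erase (Fin.castLE hn d)
        = (V.erase d).map (Fin.castLEEmb hn) := by
      intro d
      rw [Finset.map_erase]; rfl
    have hcard : ∀ d ∈ V, (V.erase d).card = k + 1 := by
      intro d hd
      rw [Finset.card_erase_of_mem hd]; omega
    right
    refine ⟨by simp [hV], Fin.castLE hn b, ?_, ?_, ?_, ?_⟩
    · exact Finset.mem_map_of_mem (Fin.castLEEmb hn) hb
    · rw [her]
      exact Finset.mem_map_of_mem (Fin.castLEEmb hn) (Finset.mem_erase.mpr ⟨hne, hmem⟩)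
    · rw [her, ← hw]
      exact ih _ (hcard b hb)
    · intro c d hd hc hcd hs
      obtain ⟨d, hdV, rfl⟩ := Finset.mem_map.mp hd
      change SSVwinAux _ _ ((V.map (Fin.castLEEmb hn)).erase (Fin.castLE hn d)) c at hs
      rw [her] at hs
      have := ssvAux_unique _ _ _ _ hs (ih _ (hcard d hdV))
      subst this
      have hdb : d ≠ b := by
        rintro rfl
        apply hcd
        rw [hw]; rfl
      have := hmax d hdV hdb
      unfold cexSucc
      simp only [Fin.castLEEmb_apply, Fin.val_castLE]
      rw [cexM_lt (Fin.is_lt _) (Fin.is_lt _), cexM_lt (Fin.is_lt _) (Fin.is_lt _)]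
      exact this

theorem ssv_ext (n : ℕ) (hn : 7 ≤ n) : ∀ k : ℕ, 7 ≤ k → k ≤ n →
    SSVwinAux (cexSucc n) k (Finset.univ.filter fun i : Fin n => (i : ℕ) < k)
      (Fin.castLE hn 2) := by
  intro k hk
  induction k, hk using Nat.le_induction with
  | base =>
    intro _
    have h := ssv_base n hn 6 Finset.univ (by simp)
    have h1 : (Finset.univ.map (Fin.castLEEmb hn))
        = (Finset.univ.filter fun i : Fin n => (i : ℕ) < 7) := by
      ext i
      simp only [Finset.mem_map, Finset.mem_univ, true_and, Finset.mem_filter]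
      constructor
      · rintro ⟨j, rfl⟩
        exact j.2
      · intro hi
        exact ⟨⟨i, hi⟩, rfl⟩
    have h2 : cexW Finset.univ = 2 := by decide +kernel
    rw [h1, h2] at h
    exact h
  | succ k hk ih =>
    intro hkn
    have ih := ih (by omega)
    have her : (Finset.univ.filter fun i : Fin n => (i : ℕ) < k + 1).erase ⟨k, by omega⟩
        = (Finset.univ.filter fun i : Fin n => (i : ℕ) < k) := by
      ext i
      simp only [Finset.mem_erase, Finset.mem_filter, Finset.mem_univ, true_and, ne_eq,
        Fin.ext_iff]
      omega
    right
    refine ⟨?_, ⟨k, by omega⟩, by simp, ?_, ?_, ?_⟩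
    · rw [Finset.one_lt_card]
      exact ⟨⟨0, by omega⟩, by simp, ⟨1, by omega⟩, by simp; omega, by simp⟩
    · rw [her]
      simp
      omega
    · rw [her]; exact ih
    · intro c d hd hc hcd hs
      by_cases hdk : d = ⟨k, by omega⟩
      · subst hdk
        rw [her] at hs
        exact absurd (by rw [ssvAux_unique _ _ _ _ hs ih]) hcd
      · simp only [Finset.mem_erase, Finset.mem_filter, Finset.mem_univ, true_and, ne_eq,
          Fin.ext_iff] at hd hc hdk
        exact cexM_dom hk (by simp; omega) (by simp only; omega) (by simp only; omega)

theorem cex_linear (n : ℕ) (hn : 7 ≤ n) :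
    IsLinearOMM (Finset.univ : Finset (Fin n)) (cexSucc n) := by
  refine ⟨⟨⟨⟨0, by omega⟩, Finset.mem_univ _⟩, ?_, ?_, ?_⟩, ?_⟩
  · intro p q _ _ _ _ h
    unfold cexSucc at *
    exact not_lt.mpr h.le
  · intro p q r _ _ _ _ _ _ h h'
    unfold cexSucc at *
    push Not at *
    exact h.trans h'
  · intro a b c d _ _ _ _
    unfold cexSucc
    simp only
    rw [cexM_skew d c, cexM_skew b a]
    omega
  · intro a b c d _ _ _ _ hab hcd hne
    unfold cexSucc
    simp only
    by_contra hcon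
    push Not at hcon
    have := cexM_inj (fun h => hab (Fin.ext h)) (fun h => hcd (Fin.ext h))
      (le_antisymm hcon.1 hcon.2)
    exact hne (Prod.ext (Fin.ext this.1) (Fin.ext this.2))

theorem cexM_six (x : ℕ) : cexM x 6 < 7 := by
  by_cases h : x < 7
  · rw [cexM_lt h (by omega)]
    exact cexT_six ⟨x, h⟩
  · rw [cexM_down (by omega) (by omega)]
    have : (0 : ℤ) ≤ (x : ℤ) * x := by positivity
    push_cast
    linarith

theorem cex_defeat (n : ℕ) (hn : 7 ≤ n) :
    SCdefeats (Finset.univ : Finset (Fin n)) (cexSucc n) (Fin.castLE hn 6)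
      (Fin.castLE hn 2) := by
  have h62 : cexM 6 2 = 7 := by decide +kernel
  have h26 : cexM 2 6 = -7 := by decide +kernel
  refine ⟨Finset.mem_univ _, Finset.mem_univ _, ?_, ?_⟩
  · change cexM 2 6 < cexM 6 2
    rw [h62, h26]; norm_num
  · rintro ⟨l, -, -, -, hmem, hweak⟩
    have h6 : Fin.castLE hn 6 ∈ l.rotate 1 := by
      rw [List.mem_rotate]
      exact (List.of_mem_zip hmem).1
    obtain ⟨i, hi, hi6⟩ := List.getElem_of_mem h6
    have hil : i < l.length := by simpa using hi
    have hz : (l[i], Fin.castLE hn 6) ∈ l.zip (l.rotate 1) := by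
      rw [← hi6, ← List.getElem_zip (h := by simp; exact hil)]
      exact List.getElem_mem _
    have := hweak _ hz
    apply this
    change cexM l[i] 6 < cexM 6 2
    rw [h62]
    exact cexM_six _

/-- For every integer `n ≥ 7`, there exists a linear ordinal margin matrix with
exactly `n` alternatives in which the SSV winner is not a Split Cycle winner. -/
theorem ssv_not_sc_counterexample_ge_seven (n : ℕ) (hn : 7 ≤ n) :
    ∃ succ : Fin n × Fin n → Fin n × Fin n → Prop,
      IsLinearOMM (Finset.univ : Finset (Fin n)) succ ∧
      ∃ a, SSVwin Finset.univ succ a ∧ ¬ SCwinner Finset.univ succ a := by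
  refine ⟨cexSucc n, cex_linear n hn, Fin.castLE hn 2, ?_, ?_⟩
  · have h := ssv_ext n hn n hn le_rfl
    have h1 : (Finset.univ.filter fun i : Fin n => (i : ℕ) < n) = Finset.univ := by
      ext i; simp
    rw [h1] at h
    unfold SSVwin
    rw [Finset.card_univ, Fintype.card_fin]
    exact h
  · intro h
    exact h.2 _ (Finset.mem_univ _) (cex_defeat n hn)
end

section
/- For any ordinal margin matrix M, there exists a preference profile P such that the ordinal margin matrix induced by P equals M. -/
variable {X : Type} [DecidableEq X]

open Classical in
/-- Rank of `x` for the voter `s` of the pair of voters attached to `(a, b)`. -/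
noncomputable def mcKey {X : Type} (e : X → ℤ) (a b : X) (s : Bool) (x : X) : ℤ :=
  if s then (if x = a then -2 else if x = b then -1 else e x)
  else (if x = a then 1 else if x = b then 2 else - e x)

theorem mcKey_pair {X : Type} [DecidableEq X] (e : X → ℤ) (he : ∀ x, 0 ≤ e x) (a b x y : X)
    (hxy : e x = e y → x = y) :
    (∑ s : Bool, ((if mcKey e a b s x < mcKey e a b s y then (1 : ℤ) else 0) -
      (if mcKey e a b s y < mcKey e a b s x then (1 : ℤ) else 0))) =
    2 * ((if x = a ∧ y = b then 1 else 0) - (if y = a ∧ x = b then 1 else 0)) := by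
  have h1 := he x
  have h2 := he y
  rw [Fintype.sum_bool]
  simp only [mcKey, if_true, Bool.false_eq_true, if_false]
  by_cases h : x = y
  · subst h; simp
  · have h3 : e x ≠ e y := fun h' => h (hxy h')
    by_cases xa : x = a <;> by_cases xb : x = b <;> by_cases ya : y = a <;> by_cases yb : y = b <;>
      simp only [xa, xb, ya, yb] at * <;> grind

open Classical in
theorem margin_eq_sum {X : Type} [DecidableEq X] {m : ℕ} (P : Fin m → X → X → Prop) (x y : X) :
    margin P x y = ∑ i, ((if P i x y then (1 : ℤ) else 0) - (if P i y x then (1 : ℤ) else 0)) := by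
  simp [margin, Finset.sum_sub_distrib]

theorem mcKey_inj {X : Type} (e : X → ℤ) (he : ∀ x, 0 ≤ e x) (a b : X) (s : Bool) (x y : X)
    (hxy : e x = e y → x = y) (h : mcKey e a b s x = mcKey e a b s y) : x = y := by
  have h1 := he x
  have h2 := he y
  unfold mcKey at h
  grind

/-- McGarvey: any natural weight is realised, up to a factor `2`, as margins. -/
theorem mcgarvey {X : Type} [DecidableEq X] (V : Finset X) (hV : V.Nonempty) (w : X × X → ℕ) :
    ∃ (m : ℕ) (P : Fin (m + 1) → X → X → Prop),
      (∀ i, IsLinOrderOn V (P i)) ∧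
      ∀ a ∈ V, ∀ b ∈ V, margin P a b = 2 * ((w (a, b) : ℤ) - w (b, a)) := by
  classical
  obtain ⟨e, he, hinj⟩ : ∃ e : X → ℤ, (∀ x, 0 ≤ e x) ∧ ∀ x ∈ V, ∀ y ∈ V, e x = e y → x = y := by
    refine ⟨fun x => if hx : x ∈ V then ((V.equivFin ⟨x, hx⟩ : ℕ) : ℤ) else 0, ?_, ?_⟩
    · intro x; dsimp only; split_ifs <;> positivity
    · intro x hx y hy h
      simp only [hx, hy, dif_pos] at h
      have h' : V.equivFin ⟨x, hx⟩ = V.equivFin ⟨y, hy⟩ := Fin.ext (by exact_mod_cast h)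
      simpa using h'
  let I := Σ p : V × V, Fin (w (p.1.1, p.2.1) + 1) × Bool
  obtain ⟨v, hv⟩ := hV
  have hI : Nonempty I := ⟨⟨(⟨v, hv⟩, ⟨v, hv⟩), 0, true⟩⟩
  obtain ⟨m, hm⟩ : ∃ m, Fintype.card I = m + 1 :=
    Nat.exists_eq_succ_of_ne_zero Fintype.card_ne_zero
  let f : Fin (m + 1) ≃ I := (Fintype.equivFinOfCardEq hm).symm
  let Q : I → X → X → Prop := fun i x y =>
    mcKey e i.1.1.1 i.1.2.1 i.2.2 x < mcKey e i.1.1.1 i.1.2.1 i.2.2 y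
  refine ⟨m, fun i => Q (f i), ?_, ?_⟩
  · intro i
    refine ⟨fun a _ => lt_irrefl _, fun a _ b _ c _ => lt_trans, fun a ha b hb hab => ?_⟩
    exact lt_or_gt_of_ne fun h => hab (mcKey_inj e he _ _ _ a b (hinj a ha b hb) h)
  · intro x hx y hy
    have e0 : margin (fun i => Q (f i)) x y = ∑ i : I,
        ((if mcKey e i.1.1.1 i.1.2.1 i.2.2 x < mcKey e i.1.1.1 i.1.2.1 i.2.2 y
            then (1 : ℤ) else 0) -
          (if mcKey e i.1.1.1 i.1.2.1 i.2.2 y < mcKey e i.1.1.1 i.1.2.1 i.2.2 x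
            then (1 : ℤ) else 0)) := by
      rw [margin_eq_sum, ← Equiv.sum_comp f]
      refine Finset.sum_congr rfl fun i _ => ?_
      congr
    rw [e0]
    rw [Fintype.sum_sigma]
    simp only [Fintype.sum_prod_type (α₁ := Fin _) (α₂ := Bool)]
    simp only [mcKey_pair e he _ _ x y (hinj x hx y hy)]
    simp only [Finset.sum_const, Finset.card_univ, Fintype.card_fin, nsmul_eq_mul]
    have key : ∀ x (hx : x ∈ V) y (hy : y ∈ V),
        ∑ p : V × V, (((w (p.1.1, p.2.1) + 1 : ℕ) : ℤ) *
          (if x = p.1.1 ∧ y = p.2.1 then 1 else 0)) = w (x, y) + 1 := by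
      intro x hx y hy
      rw [Finset.sum_eq_single (⟨x, hx⟩, ⟨y, hy⟩)]
      · simp
      · rintro ⟨⟨a, ha⟩, ⟨b, hb⟩⟩ _ hne
        have : ¬ (x = a ∧ y = b) := by rintro ⟨rfl, rfl⟩; exact hne rfl
        simp [this]
      · simp
    have e1 : ∀ p : V × V, (((w (p.1.1, p.2.1) + 1 : ℕ) : ℤ) *
        (2 * ((if x = p.1.1 ∧ y = p.2.1 then 1 else 0) -
          (if y = p.1.1 ∧ x = p.2.1 then 1 else 0)))) =
        2 * ((((w (p.1.1, p.2.1) + 1 : ℕ) : ℤ) * (if x = p.1.1 ∧ y = p.2.1 then 1 else 0)) -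
        (((w (p.1.1, p.2.1) + 1 : ℕ) : ℤ) * (if y = p.1.1 ∧ x = p.2.1 then 1 else 0))) := by
      intro p; ring
    rw [Finset.sum_congr rfl (fun p _ => e1 p), ← Finset.mul_sum, Finset.sum_sub_distrib,
      key x hx y hy, key y hy x hx]
    ring

/-- For any ordinal margin matrix `M`, there exists a preference profile `P`
(a nonempty finite set of voters, each with a strict linear order on the alternatives)
whose induced ordinal margin matrix equals `M`, i.e., for all alternatives
`(a,b) ≻ (c,d)` iff `Margin_P(a,b) > Margin_P(c,d)`. -/
theorem omm_representation {X : Type} [DecidableEq X] (V : Finset X)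
    (succ : X × X → X × X → Prop) (h : IsOMM V succ) :
    ∃ (m : ℕ) (P : Fin (m + 1) → X → X → Prop),
      (∀ i, IsLinOrderOn V (P i)) ∧
      ∀ a ∈ V, ∀ b ∈ V, ∀ c ∈ V, ∀ d ∈ V,
        (succ (a, b) (c, d) ↔ margin P a b > margin P c d) := by
  classical
  obtain ⟨hne, hasym, hneg, hskew⟩ := h
  let w : X × X → ℕ := fun p => ((V ×ˢ V).filter fun q => succ p q).card
  obtain ⟨m, P, hP, hM⟩ := mcgarvey V hne w
  have w_le : ∀ p q : X × X, p.1 ∈ V → p.2 ∈ V → q.1 ∈ V → q.2 ∈ V → ¬ succ p q → w p ≤ w q := by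
    intro p q h1 h2 h3 h4 hn
    apply Finset.card_le_card
    intro r hr
    simp only [Finset.mem_filter, Finset.mem_product] at hr ⊢
    refine ⟨hr.1, ?_⟩
    by_contra hq
    exact hneg p q r h1 h2 h3 h4 hr.1.1 hr.1.2 hn hq hr.2
  have w_lt : ∀ p q : X × X, p.1 ∈ V → p.2 ∈ V → q.1 ∈ V → q.2 ∈ V → succ p q → w q < w p := by
    intro p q h1 h2 h3 h4 hs
    apply Finset.card_lt_card
    rw [Finset.ssubset_iff_of_subset]
    · refine ⟨q, ?_, ?_⟩
      · simp [h3, h4, hs]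
      · simp only [Finset.mem_filter, not_and]
        exact fun _ hq => hasym q q h3 h4 h3 h4 hq hq
    · intro r hr
      simp only [Finset.mem_filter, Finset.mem_product] at hr ⊢
      refine ⟨hr.1, ?_⟩
      by_contra hq
      exact hneg q p r h3 h4 h1 h2 hr.1.1 hr.1.2 (hasym p q h1 h2 h3 h4 hs) hq hr.2
  refine ⟨m, P, hP, fun a ha b hb c hc d hd => ?_⟩
  rw [hM a ha b hb, hM c hc d hd]
  have hsk := hskew a b c d ha hb hc hd
  constructor
  · intro hs
    have h1 := w_lt _ _ ha hb hc hd hs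
    have h2 := w_lt _ _ hd hc hb ha (hsk.1 hs)
    omega
  · intro hlt
    by_contra hs
    have h1 := w_le _ _ ha hb hc hd hs
    have h2 := w_le _ _ hd hc hb ha (fun h => hs (hsk.2 h))
    omega
end
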